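/- Let n ≥ 2 and let A be the n-qubit staircase architecture with R = T(n−1) gates, consisting of T consecutive blocks, each block applying gates at the pairs (1,2), (2,3), …, (n−1,n) in this order. If T ≤ 4^n − 1, then (i) each block of n−1 gates is a causal slice with sink qubit n, and (ii) for μ-almost every x ∈ SU(4)^{×R}, the implemented unitary satisfies C_u(F^A(x)) ≥ R/(9(n−1)) − n/3. -/

import Mathlib

open scoped Matrix ENNReal Classical Kronecker ComplexOrder
open MeasureTheory

/-! ## Basic objects: qubit bases, gates, architectures, contraction maps -/

/-- Computational-basis index set for `n` qubits. -/
abbrev QubitBasis (n : ℕ) := Fin n → Fin 2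

/-- `2^n × 2^n` complex matrices, indexed by the computational basis of `n` qubits. -/
abbrev NMatrix (n : ℕ) := Matrix (QubitBasis n) (QubitBasis n) ℂ

/-- The special unitary group `SU(4)` of two-qubit gates. -/
abbrev SU4 := Matrix.specialUnitaryGroup (Fin 4) ℂ

/-- An architecture on `n` qubits with `R` gates: a list of ordered pairs of distinct qubits. -/
def Architecture (n R : ℕ) := Fin R → {p : Fin n × Fin n // p.1 ≠ p.2}

/-- Identification of a pair of one-qubit basis indices with a two-qubit basis index. -/
def pairIdx (a b : Fin 2) : Fin 4 := ⟨2 * a.val + b.val, by omega⟩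

/-- The `n`-qubit matrix given by letting the two-qubit matrix `u` act on the
tensor factors `p.1` and `p.2`, and as the identity on all other factors. -/
noncomputable def embedGate {n : ℕ} (p : Fin n × Fin n) (u : Matrix (Fin 4) (Fin 4) ℂ) :
    NMatrix n := fun a b =>
  if (∀ i, i ≠ p.1 → i ≠ p.2 → a i = b i)
  then u (pairIdx (a p.1) (a p.2)) (pairIdx (b p.1) (b p.2)) else 0

/-- The list of `n`-qubit gates obtained by substituting the gates `x` into
the architecture `A`. -/
noncomputable def gateList {n R : ℕ} (A : Architecture n R) (x : Fin R → SU4) :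
    List (NMatrix n) :=
  List.ofFn fun i => embedGate (A i).1 (x i : Matrix (Fin 4) (Fin 4) ℂ)

/-- The contraction map `F^A` of an architecture `A`: it sends a tuple of two-qubit gates
`(u_1, …, u_R)` to the `n`-qubit unitary `(u_R)_{p_R} ⋯ (u_1)_{p_1}`. -/
noncomputable def contract {n R : ℕ} (A : Architecture n R) (x : Fin R → SU4) : NMatrix n :=
  ((gateList A x).reverse).prod

/-- The exact circuit complexity: the least number `R` of two-qubit gates, arranged in any
architecture, implementing the matrix `U`. -/
noncomputable def Cu (n : ℕ) (U : NMatrix n) : ℕ :=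
  sInf {R | ∃ A : Architecture n R, ∃ x : Fin R → SU4, contract A x = U}

/-- The all-zeros computational basis state `|0^n⟩`. -/
noncomputable def ket0 (n : ℕ) : QubitBasis n → ℂ := fun a => if a = fun _ => 0 then 1 else 0

/-- The exact state complexity: the least number `R` of two-qubit gates, arranged in any
architecture, producing `ψ` from `|0^n⟩`. -/
noncomputable def Cstate (n : ℕ) (ψ : QubitBasis n → ℂ) : ℕ :=
  sInf {R | ∃ A : Architecture n R, ∃ x : Fin R → SU4, (contract A x) *ᵥ ket0 n = ψ}

/-- The gates with indices `lo ≤ i < hi` of `A` form a causal slice with sink qubit `t`: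
every qubit `q` is connected to `t` by a path through gates of the slice, taken in
increasing index order. -/
def IsCausalSliceWith {n R : ℕ} (A : Architecture n R) (lo hi : ℕ) (t : Fin n) : Prop :=
  ∀ q : Fin n, ∃ (m : ℕ) (idx : Fin m → Fin R) (qs : Fin (m + 1) → Fin n),
    StrictMono idx ∧ (∀ l, lo ≤ (idx l : ℕ) ∧ (idx l : ℕ) < hi) ∧
    qs 0 = q ∧ qs (Fin.last m) = t ∧
    ∀ l : Fin m,
      (qs l.castSucc = (A (idx l)).1.1 ∨ qs l.castSucc = (A (idx l)).1.2) ∧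
      (qs l.succ = (A (idx l)).1.1 ∨ qs l.succ = (A (idx l)).1.2)

/-- The gates with indices `lo ≤ i < hi` of `A` form a causal slice. -/
def IsCausalSlice {n R : ℕ} (A : Architecture n R) (lo hi : ℕ) : Prop :=
  ∃ t, IsCausalSliceWith A lo hi t

/-! ## Group, topological, measurable and compactness structure on `SU(4)`,
and its Haar probability measure -/

namespace SU4

theorem star_mem {U : Matrix (Fin 4) (Fin 4) ℂ}
    (hU : U ∈ Matrix.specialUnitaryGroup (Fin 4) ℂ) :
    star U ∈ Matrix.specialUnitaryGroup (Fin 4) ℂ := by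
  rw [Matrix.mem_specialUnitaryGroup_iff] at hU ⊢
  refine ⟨Unitary.star_mem hU.1, ?_⟩
  have : (star U).det = star U.det := by
    simp [Matrix.star_eq_conjTranspose, Matrix.det_conjTranspose]
  rw [this, hU.2]
  simp

noncomputable instance : Group SU4 :=
  { (inferInstance : Monoid SU4) with
    inv := fun U => ⟨star U.1, star_mem U.2⟩
    inv_mul_cancel := fun U => Subtype.ext <| by
      have h := (Matrix.mem_specialUnitaryGroup_iff.mp U.2).1.1
      simpa using h }

instance : IsTopologicalGroup SU4 where
  continuous_mul := by
    apply Continuous.subtype_mk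
    exact ((continuous_subtype_val.comp continuous_fst).matrix_mul
      (continuous_subtype_val.comp continuous_snd))
  continuous_inv := by
    apply Continuous.subtype_mk
    exact continuous_star.comp continuous_subtype_val

noncomputable instance : MeasurableSpace (Matrix (Fin 4) (Fin 4) ℂ) :=
  inferInstanceAs (MeasurableSpace (Fin 4 → Fin 4 → ℂ))

instance : BorelSpace (Matrix (Fin 4) (Fin 4) ℂ) :=
  inferInstanceAs (BorelSpace (Fin 4 → Fin 4 → ℂ))

theorem isClosed :
    IsClosed (Matrix.specialUnitaryGroup (Fin 4) ℂ : Set (Matrix (Fin 4) (Fin 4) ℂ)) := by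
  have h1 : IsClosed {M : Matrix (Fin 4) (Fin 4) ℂ | star M * M = 1} :=
    isClosed_eq ((continuous_id.matrix_conjTranspose).matrix_mul continuous_id) continuous_const
  have h2 : IsClosed {M : Matrix (Fin 4) (Fin 4) ℂ | M * star M = 1} :=
    isClosed_eq (continuous_id.matrix_mul (continuous_id.matrix_conjTranspose)) continuous_const
  have h3 : IsClosed {M : Matrix (Fin 4) (Fin 4) ℂ | M.det = 1} :=
    isClosed_eq continuous_id.matrix_det continuous_const
  have : (Matrix.specialUnitaryGroup (Fin 4) ℂ : Set (Matrix (Fin 4) (Fin 4) ℂ)) =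
      ({M | star M * M = 1} ∩ {M | M * star M = 1}) ∩ {M | M.det = 1} := by
    ext M
    simp only [SetLike.mem_coe, Matrix.mem_specialUnitaryGroup_iff, Unitary.mem_iff,
      Set.mem_inter_iff, Set.mem_setOf_eq]
  rw [this]
  exact ((h1.inter h2)).inter h3

theorem isCompact :
    IsCompact (Matrix.specialUnitaryGroup (Fin 4) ℂ : Set (Matrix (Fin 4) (Fin 4) ℂ)) := by
  have hK : IsCompact (Set.pi Set.univ fun _ : Fin 4 => Set.pi Set.univ fun _ : Fin 4 =>
      Metric.closedBall (0 : ℂ) 1 : Set (Matrix (Fin 4) (Fin 4) ℂ)) :=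
    isCompact_univ_pi fun _ => isCompact_univ_pi fun _ => isCompact_closedBall _ _
  refine IsCompact.of_isClosed_subset hK isClosed ?_
  intro M hM
  refine fun i _ => fun j _ => ?_
  simp only [Metric.mem_closedBall, dist_zero_right]
  exact entry_norm_bound_of_unitary (Matrix.mem_specialUnitaryGroup_iff.mp hM).1 i j

instance : CompactSpace SU4 :=
  isCompact_iff_compactSpace.mp isCompact

noncomputable instance : MeasurableSpace SU4 := borel SU4

instance : BorelSpace SU4 := ⟨rfl⟩

end SU4

/-- The Haar probability measure on `SU(4)`. -/
noncomputable def haarSU4 : Measure SU4 :=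
  Measure.haarMeasure ⟨⟨Set.univ, isCompact_univ⟩, by simp⟩

instance : IsProbabilityMeasure haarSU4 := by
  constructor
  have h : Measure.haarMeasure
      (⟨⟨Set.univ, isCompact_univ⟩, by simp⟩ : TopologicalSpace.PositiveCompacts SU4)
      (⟨⟨Set.univ, isCompact_univ⟩, by simp⟩ : TopologicalSpace.PositiveCompacts SU4) = 1 :=
    Measure.haarMeasure_self
  simpa [haarSU4] using h

/-- The product of Haar probability measures on `SU(4)^{×R}`: the distribution of a random
quantum circuit with `R` gates in a fixed architecture. -/
noncomputable def muSU4 (R : ℕ) : Measure (Fin R → SU4) :=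
  Measure.pi fun _ => haarSU4

/-! ## The differential of the contraction map, its rank, and the accessible dimension -/

/-- The Lie algebra `su(m)` of traceless skew-Hermitian matrices, as a real subspace. -/
noncomputable def suAlgebra (m : Type*) [Fintype m] [DecidableEq m] :
    Submodule ℝ (Matrix m m ℂ) :=
  Submodule.span ℝ {H | Hᴴ = -H ∧ H.trace = 0}

/-- `embedGate` as a real-linear map in the gate entry. -/
noncomputable def embedLin {n : ℕ} (p : Fin n × Fin n) :
    Matrix (Fin 4) (Fin 4) ℂ →ₗ[ℝ] NMatrix n where
  toFun := embedGate p
  map_add' u v := by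
    funext a b
    simp only [embedGate, Matrix.add_apply]
    split <;> simp
  map_smul' r u := by
    funext a b
    simp only [embedGate, Matrix.smul_apply, RingHom.id_apply]
    split <;> simp

/-- The differential of the contraction map `F^A` at the point `x ∈ SU(4)^{×R}`, read in the
exponential charts: the direction `(H_1, …, H_R)` is mapped to
`∑_j (U_R)_{p_R} ⋯ (U_{j+1})_{p_{j+1}} · (H_j)_{p_j} · (U_j)_{p_j} ⋯ (U_1)_{p_1}`. -/
noncomputable def contractDiff {n R : ℕ} (A : Architecture n R) (x : Fin R → SU4) :
    (Fin R → Matrix (Fin 4) (Fin 4) ℂ) →ₗ[ℝ] NMatrix n :=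
  ∑ j : Fin R,
    (LinearMap.mulLeft ℝ (((gateList A x).drop (j + 1)).reverse.prod)) ∘ₗ
      (LinearMap.mulRight ℝ
        (embedGate (A j).1 (x j : Matrix (Fin 4) (Fin 4) ℂ) *
          ((gateList A x).take j).reverse.prod)) ∘ₗ
      (embedLin (A j).1) ∘ₗ
      (LinearMap.proj j)

/-- The rank of (the differential of) the contraction map `F^A` at `x`: the dimension of
the image, under the differential, of the tangent space `su(4)^{×R}`. -/
noncomputable def rankAt {n R : ℕ} (A : Architecture n R) (x : Fin R → SU4) : ℕ :=
  Module.finrank ℝ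
    ↥(Submodule.map (contractDiff A x) (Submodule.pi Set.univ fun _ => suAlgebra (Fin 4)))

/-- The maximal rank `r_max` of the contraction map `F^A` over all points of `SU(4)^{×R}`. -/
noncomputable def rmax {n R : ℕ} (A : Architecture n R) : ℕ := ⨆ x, rankAt A x

/-- A matrix viewed as a point of the Euclidean (Frobenius) space of its entries. -/
noncomputable def toEuc {n : ℕ} (M : NMatrix n) :
    EuclideanSpace ℂ (QubitBasis n × QubitBasis n) := WithLp.toLp 2 fun p => M p.1 p.2

/-- The Frobenius norm `‖X‖_F = (tr (X† X))^{1/2}` of an `n`-qubit matrix. -/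
noncomputable def frobNorm {n : ℕ} (M : NMatrix n) : ℝ := ‖toEuc M‖

/-- The accessible dimension `d_A` of an architecture `A`: the Hausdorff dimension of the
set `U(A)` of unitaries implementable with `A`, with respect to the Frobenius metric. -/
noncomputable def accessibleDim {n R : ℕ} (A : Architecture n R) : ℝ≥0∞ :=
  dimH (toEuc '' Set.range (contract A))

/-! ## Pauli strings and Clifford gates -/

/-- The Pauli matrices `1, X, Y, Z`. -/
noncomputable def pauli : Fin 4 → Matrix (Fin 2) (Fin 2) ℂ
  | 0 => 1
  | 1 => !![0, 1; 1, 0]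
  | 2 => !![0, -Complex.I; Complex.I, 0]
  | 3 => !![1, 0; 0, -1]

/-- The `n`-qubit Pauli string `⨂ᵢ pauli (s i)`. -/
noncomputable def pauliString {n : ℕ} (s : Fin n → Fin 4) : NMatrix n :=
  fun a b => ∏ i, pauli (s i) (a i) (b i)

/-- A two-qubit Pauli string, as a `4 × 4` matrix. -/
noncomputable def pauli2 (s : Fin 2 → Fin 4) : Matrix (Fin 4) (Fin 4) ℂ :=
  fun a b =>
    pauli (s 0) ⟨a.val / 2, by have := a.isLt; omega⟩ ⟨b.val / 2, by have := b.isLt; omega⟩ *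
    pauli (s 1) ⟨a.val % 2, by have := a.isLt; omega⟩ ⟨b.val % 2, by have := b.isLt; omega⟩

/-- A two-qubit gate is Clifford if it maps every Pauli string to a scalar multiple of a
Pauli string under conjugation. -/
def IsCliffordGate (u : Matrix (Fin 4) (Fin 4) ℂ) : Prop :=
  ∀ s : Fin 2 → Fin 4, ∃ (c : ℂ) (s' : Fin 2 → Fin 4),
    u * pauli2 s * uᴴ = c • pauli2 s'

/-- Application to the state `|0^n⟩`, `M ↦ M |0^n⟩`, as a real-linear map. -/
noncomputable def mulVecKet0 (n : ℕ) : NMatrix n →ₗ[ℝ] (QubitBasis n → ℂ) where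
  toFun M := M *ᵥ ket0 n
  map_add' M N := Matrix.add_mulVec M N (ket0 n)
  map_smul' r M := by
    simp only [RingHom.id_apply]
    exact Matrix.smul_mulVec r M (ket0 n)

/-- The rank of (the differential of) the map `G^A : x ↦ F^A(x)|0^n⟩` at `x`. -/
noncomputable def stateRankAt {n R : ℕ} (A : Architecture n R) (x : Fin R → SU4) : ℕ :=
  Module.finrank ℝ
    ↥(Submodule.map ((mulVecKet0 n) ∘ₗ contractDiff A x)
      (Submodule.pi Set.univ fun _ => suAlgebra (Fin 4)))

/-! ## Trace norm and operator norm -/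

/-- The positive semidefinite square root of a positive semidefinite matrix
(the former Mathlib definition `Matrix.PosSemidef.sqrt`). -/
noncomputable def Matrix.PosSemidef.sqrt {n 𝕜 : Type*} [Fintype n] [RCLike 𝕜] [DecidableEq n]
    {A : Matrix n n 𝕜} (hA : Matrix.PosSemidef A) : Matrix n n 𝕜 :=
  hA.1.eigenvectorUnitary.1 * Matrix.diagonal ((↑) ∘ Real.sqrt ∘ hA.1.eigenvalues) *
  (star hA.1.eigenvectorUnitary : Matrix n n 𝕜)

/-- The trace norm `‖M‖₁ = tr ((M† M)^{1/2})` of a square complex matrix. -/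
noncomputable def traceNorm {m : Type*} [Fintype m] [DecidableEq m] (M : Matrix m m ℂ) : ℝ :=
  ((Matrix.posSemidef_conjTranspose_mul_self M).sqrt.trace).re

/-- The operator norm (largest singular value) of a square complex matrix: the norm of the
induced operator between Euclidean spaces. -/
noncomputable def opNorm {m : Type*} [Fintype m] [DecidableEq m] (M : Matrix m m ℂ) : ℝ :=
  ‖LinearMap.toContinuousLinearMap (Matrix.toEuclideanLin M)‖

/-! ## The uniform measure on a finite index set -/

/-- The uniform probability measure on `Fin m`. -/
noncomputable def uniformFin (m : ℕ) : Measure (Fin m) :=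
  ((m : ℝ≥0∞))⁻¹ • Measure.count

instance (m : ℕ) : IsFiniteMeasure (uniformFin m) := by
  constructor
  rw [uniformFin, Measure.smul_apply, smul_eq_mul, Measure.count_univ,
    ENat.card_eq_coe_fintype_card, Fintype.card_fin, ENat.toENNReal_coe]
  rcases Nat.eq_zero_or_pos m with h | h
  · simp [h]
  · rw [ENNReal.inv_mul_cancel (by exact_mod_cast h.ne') (by simp)]
    exact ENNReal.one_lt_top

/-! ## Statement 15: the staircase architecture -/

/-- The `n`-qubit staircase architecture with `T` blocks of `n−1` gates each: each block
applies gates at the (0-indexed) pairs `(0,1), (1,2), …, (n−2,n−1)`, in this order. -/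
def staircase (n T : ℕ) (hn : 2 ≤ n) : Architecture n (T * (n - 1)) := fun i =>
  ⟨(⟨(i : ℕ) % (n - 1), by have := Nat.mod_lt (i : ℕ) (y := n - 1) (by omega); omega⟩,
    ⟨(i : ℕ) % (n - 1) + 1, by have := Nat.mod_lt (i : ℕ) (y := n - 1) (by omega); omega⟩),
    Fin.ne_of_val_ne (by show (i : ℕ) % (n - 1) ≠ (i : ℕ) % (n - 1) + 1; omega)⟩

section PolyTools
open Filter Topology

/-- polynomial functions -/
def QPoly {σ : Type} (f : (σ → ℂ) → ℂ) : Prop :=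
  ∃ q : MvPolynomial σ ℂ, ∀ z, f z = MvPolynomial.eval z q

theorem QPoly.const {σ : Type} (c : ℂ) : QPoly (fun _ : σ → ℂ => c) :=
  ⟨MvPolynomial.C c, fun z => by simp⟩

theorem QPoly.coord {σ : Type} (i : σ) : QPoly (fun z : σ → ℂ => z i) :=
  ⟨MvPolynomial.X i, fun z => by simp⟩

theorem QPoly.add {σ : Type} {f g : (σ → ℂ) → ℂ} (hf : QPoly f) (hg : QPoly g) :
    QPoly (fun z => f z + g z) := by
  obtain ⟨p, hp⟩ := hf
  obtain ⟨q, hq⟩ := hg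
  exact ⟨p + q, fun z => by simp [hp, hq]⟩

theorem QPoly.mul {σ : Type} {f g : (σ → ℂ) → ℂ} (hf : QPoly f) (hg : QPoly g) :
    QPoly (fun z => f z * g z) := by
  obtain ⟨p, hp⟩ := hf
  obtain ⟨q, hq⟩ := hg
  exact ⟨p * q, fun z => by simp [hp, hq]⟩

theorem QPoly.sum {σ ι : Type} (s : Finset ι) {f : ι → (σ → ℂ) → ℂ} (hf : ∀ i, QPoly (f i)) :
    QPoly (fun z => ∑ i ∈ s, f i z) := by
  choose p hp using hf
  exact ⟨∑ i ∈ s, p i, fun z => by simp [hp]⟩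

theorem QPoly.prod {σ ι : Type} (s : Finset ι) {f : ι → (σ → ℂ) → ℂ} (hf : ∀ i, QPoly (f i)) :
    QPoly (fun z => ∏ i ∈ s, f i z) := by
  choose p hp using hf
  exact ⟨∏ i ∈ s, p i, fun z => by simp [hp]⟩

theorem QPoly.comp {σ ι : Type} (P : MvPolynomial ι ℂ) {f : ι → (σ → ℂ) → ℂ}
    (hf : ∀ i, QPoly (f i)) : QPoly (fun z => MvPolynomial.eval (fun i => f i z) P) := by
  choose p hp using hf
  refine ⟨MvPolynomial.bind₁ p P, fun z => ?_⟩
  simp only [hp]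
  rw [← MvPolynomial.coe_aeval_eq_eval z, RingHom.coe_coe, MvPolynomial.aeval_bind₁]
  rw [← MvPolynomial.coe_aeval_eq_eval]
  rfl

/-- matrix-valued polynomial functions -/
def QPolyM {σ m k : Type} (M : (σ → ℂ) → Matrix m k ℂ) : Prop :=
  ∀ a b, QPoly (fun z => M z a b)

theorem QPolyM.const {σ m k : Type} (c : Matrix m k ℂ) : QPolyM (fun _ : σ → ℂ => c) :=
  fun _ _ => QPoly.const _

theorem QPolyM.add {σ m k : Type} {f g : (σ → ℂ) → Matrix m k ℂ} (hf : QPolyM f)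
    (hg : QPolyM g) : QPolyM (fun z => f z + g z) :=
  fun a b => (hf a b).add (hg a b)

theorem QPolyM.smul {σ m k : Type} {f : (σ → ℂ) → ℂ} {g : (σ → ℂ) → Matrix m k ℂ}
    (hf : QPoly f) (hg : QPolyM g) : QPolyM (fun z => f z • g z) :=
  fun a b => hf.mul (hg a b)

theorem QPolyM.sum {σ ι m k : Type} (s : Finset ι) {f : ι → (σ → ℂ) → Matrix m k ℂ}
    (hf : ∀ i, QPolyM (f i)) : QPolyM (fun z => ∑ i ∈ s, f i z) := by
  intro a b
  simp only [Matrix.sum_apply]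
  exact QPoly.sum s fun i => hf i a b

theorem QPolyM.mul {σ m k l : Type} [Fintype k] {f : (σ → ℂ) → Matrix m k ℂ}
    {g : (σ → ℂ) → Matrix k l ℂ}
    (hf : QPolyM f) (hg : QPolyM g) : QPolyM (fun z => f z * g z) := by
  intro a b
  simp only [Matrix.mul_apply]
  exact QPoly.sum _ fun i => (hf a i).mul (hg i b)

theorem QPolyM.linear {σ m k ι : Type} [Fintype m] [Fintype k] {f : (σ → ℂ) → Matrix m k ℂ}
    (hf : QPolyM f) (l : Matrix m k ℂ →ₗ[ℂ] (ι → ℂ)) (i : ι) : QPoly (fun z => l (f z) i) := by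
  have : ∀ M : Matrix m k ℂ, l M i = ∑ a, ∑ b, M a b * l (Matrix.single a b 1) i := by
    intro M
    conv_lhs => rw [Matrix.matrix_eq_sum_single M]
    simp only [map_sum, Finset.sum_apply]
    refine Finset.sum_congr rfl fun a _ => Finset.sum_congr rfl fun b _ => ?_
    have : Matrix.single a b (M a b) = M a b • Matrix.single a b (1 : ℂ) := by simp
    rw [this, map_smul]
    rfl
  have h2 : (fun z => l (f z) i) =
      fun z => ∑ a, ∑ b, f z a b * l (Matrix.single a b 1) i := funext fun z => this (f z)
  rw [h2]
  exact QPoly.sum _ fun a => QPoly.sum _ fun b => (hf a b).mul (QPoly.const _)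

theorem QPoly.analyticAt {σ : Type} [Fintype σ] {f : (σ → ℂ) → ℂ} (hf : QPoly f) (p : σ → ℂ) :
    AnalyticAt ℂ f p := by
  obtain ⟨q, hq⟩ := hf
  have : f = fun z => MvPolynomial.eval z q := funext hq
  rw [this]
  exact AnalyticOnNhd.eval_mvPolynomial q p (Set.mem_univ _)

theorem MvPoly_zero_of_eventually {σ : Type} [Fintype σ] (q : MvPolynomial σ ℂ) (p : σ → ℂ)
    (h : ∀ᶠ z in 𝓝 p, MvPolynomial.eval z q = 0) : q = 0 := by
  have h1 : ∀ z, MvPolynomial.eval z q = 0 := by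
    have := AnalyticOnNhd.eq_of_eventuallyEq (f := fun z => MvPolynomial.eval z q)
      (g := fun _ => (0 : ℂ)) (z₀ := p)
      (AnalyticOnNhd.eval_mvPolynomial q) (fun _ _ => analyticAt_const) h
    exact fun z => congrFun this z
  exact MvPolynomial.funext fun z => by simp [h1 z]

theorem QPoly.zero_of_eventually {σ : Type} [Fintype σ] {f : (σ → ℂ) → ℂ} (hf : QPoly f)
    (p : σ → ℂ) (h : ∀ᶠ z in 𝓝 p, f z = 0) (z : σ → ℂ) : f z = 0 := by
  obtain ⟨q, hq⟩ := hf
  simp only [hq] at h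
  rw [hq, MvPoly_zero_of_eventually q p h, map_zero]

theorem QPoly.zero_of_real {σ : Type} [Fintype σ] {f : (σ → ℂ) → ℂ} (hf : QPoly f)
    (h : ∀ s : σ → ℝ, f (fun i => (s i : ℂ)) = 0) (z : σ → ℂ) : f z = 0 := by
  obtain ⟨q, hq⟩ := hf
  have : q = 0 := by
    refine MvPolynomial.funext_set (s := fun _ => Set.range (fun x : ℝ => (x : ℂ)))
      (fun _ => Set.infinite_range_of_injective Complex.ofReal_injective) ?_
    intro x hx
    have hx' : ∀ i, ∃ y : ℝ, (y : ℂ) = x i := fun i => hx i (Set.mem_univ _)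
    choose y hy using hx'
    have := h y
    rw [hq] at this
    have hxy : x = fun i => (y i : ℂ) := funext fun i => (hy i).symm
    rw [hxy, this, map_zero]
  rw [hq, this, map_zero]

theorem open_of_affine {σ : Type} [Fintype σ] {E : Type*} [NormedAddCommGroup E]
    [NormedSpace ℂ E] [CompleteSpace E] (f : (σ → ℂ) → E) (p : σ → ℂ)
    (hf : AnalyticAt ℂ f p) (v : σ → E)
    (h : ∀ i (t : ℂ), f (p + t • Pi.single i 1) = f p + t • v i)
    (hs : Submodule.span ℂ (Set.range v) = ⊤) : Filter.map f (𝓝 p) = 𝓝 (f p) := by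
  have hd := hf.hasStrictFDerivAt
  refine hd.map_nhds_eq_of_surj ?_
  have hv : ∀ i, fderiv ℂ f p (Pi.single i 1) = v i := by
    intro i
    have h1 : HasDerivAt (fun t : ℂ => f (p + t • Pi.single i 1))
        (fderiv ℂ f p (Pi.single i 1)) 0 := by
      have := hd.hasFDerivAt.hasLineDerivAt (Pi.single i (1 : ℂ))
      exact this
    have h2 : HasDerivAt (fun t : ℂ => f (p + t • Pi.single i 1)) (v i) 0 := by
      simp only [h]
      simpa using ((hasDerivAt_id (0 : ℂ)).smul_const (v i)).const_add (f p)
    exact h1.unique h2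
  rw [eq_top_iff, ← hs, Submodule.span_le]
  rintro _ ⟨i, rfl⟩
  exact ⟨Pi.single i 1, hv i⟩

theorem open_of_affine_pi {σ τ : Type} [Fintype σ] [Fintype τ] (f : (σ → ℂ) → (τ → ℂ))
    (p : σ → ℂ) (hf : ∀ j, QPoly (fun z => f z j)) (v : σ → τ → ℂ)
    (h : ∀ i (t : ℂ), f (p + t • Pi.single i 1) = f p + t • v i)
    (hs : Submodule.span ℂ (Set.range v) = ⊤) : Filter.map f (𝓝 p) = 𝓝 (f p) :=
  open_of_affine f p (analyticAt_pi_iff.2 fun j => (hf j).analyticAt p) v h hs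

theorem open_of_affine_mat {σ m k : Type} [Fintype σ] [Fintype m] [Fintype k]
    (f : (σ → ℂ) → Matrix m k ℂ)
    (p : σ → ℂ) (hf : QPolyM f) (v : σ → Matrix m k ℂ)
    (h : ∀ i (t : ℂ), f (p + t • Pi.single i 1) = f p + t • v i)
    (hs : Submodule.span ℂ (Set.range v) = ⊤) : Filter.map f (𝓝 p) = 𝓝 (f p) := by
  refine open_of_affine (E := m → k → ℂ) f p ?_ v h hs
  rw [analyticAt_pi_iff]
  intro a
  rw [analyticAt_pi_iff]
  intro b
  exact (hf a b).analyticAt p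

theorem ae_eval_ne_zero : ∀ (d : ℕ) (q : MvPolynomial (Fin d) ℂ), q ≠ 0 →
    ∀ᵐ s : Fin d → ℝ, MvPolynomial.eval (fun i => (s i : ℂ)) q ≠ 0 := by
  intro d
  induction d with
  | zero =>
    intro q hq
    refine Filter.Eventually.of_forall fun s h => hq ?_
    refine MvPolynomial.funext fun z => ?_
    rw [map_zero, ← h]
    congr 2
    exact Subsingleton.elim _ _
  | succ d ih =>
    intro q hq
    set Q := MvPolynomial.finSuccEquiv ℂ d q with hQ
    have hQ0 : Q ≠ 0 := by simpa [hQ] using hq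
    have hl : Q.leadingCoeff ≠ 0 := by simpa using hQ0
    have h1 := ih _ hl
    have hmp := (volume_preserving_piFinSuccAbove (fun _ : Fin (d+1) => ℝ) 0)
    have hmeas : MeasurableSet {y : ℝ × (Fin d → ℝ) |
        MvPolynomial.eval (Fin.cons (y.1 : ℂ) (fun i => (y.2 i : ℂ)) : Fin (d+1) → ℂ) q ≠ 0} := by
      apply IsOpen.measurableSet
      apply isOpen_ne_fun _ continuous_const
      apply (MvPolynomial.continuous_eval q).comp
      refine continuous_pi fun i => ?_
      refine Fin.cases ?_ (fun j => ?_) i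
      · simp only [Fin.cons_zero]; fun_prop
      · simp only [Fin.cons_succ]; fun_prop
    have key : ∀ᵐ y : ℝ × (Fin d → ℝ),
        MvPolynomial.eval (Fin.cons (y.1 : ℂ) (fun i => (y.2 i : ℂ)) : Fin (d+1) → ℂ) q ≠ 0 := by
      have hsw : ∀ᵐ y : (Fin d → ℝ) × ℝ,
        MvPolynomial.eval (Fin.cons (y.2 : ℂ) (fun i => (y.1 i : ℂ)) : Fin (d+1) → ℂ) q ≠ 0 := by
        rw [Measure.volume_eq_prod]
        refine (Measure.ae_prod_iff_ae_ae (measurable_swap hmeas)).2 ?_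
        filter_upwards [h1] with s hs
        set g := Polynomial.map (MvPolynomial.eval (fun i => (s i : ℂ))) Q with hg
        have hg0 : g ≠ 0 := by
          intro h0
          apply hs
          have := congrArg (fun r => Polynomial.coeff r Q.natDegree) h0
          simpa [hg, Polynomial.coeff_map] using this
        have hfin : {t : ℝ | g.eval (t : ℂ) = 0}.Finite := by
          have : (g.roots.toFinset : Set ℂ).Finite := Finset.finite_toSet _
          refine (this.preimage (f := fun t : ℝ => (t : ℂ))
            Complex.ofReal_injective.injOn).subset ?_
          intro t ht
          simpa [hg0] using ht
        have := hfin.measure_zero volume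
        rw [ae_iff]
        convert this using 3
        ext t
        rw [MvPolynomial.eval_eq_eval_mv_eval']
        simp [hg, hQ]
      have hq2 : Measure.QuasiMeasurePreserving (Prod.swap : ℝ × (Fin d → ℝ) → (Fin d → ℝ) × ℝ)
          volume volume := by
        have : MeasurePreserving (Prod.swap : ℝ × (Fin d → ℝ) → (Fin d → ℝ) × ℝ)
          volume volume := Measure.measurePreserving_swap
        exact this.quasiMeasurePreserving
      exact hq2.ae hsw
    have := hmp.quasiMeasurePreserving.ae key
    filter_upwards [this] with s hs
    convert hs using 2
    congr 1
    funext i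
    refine Fin.cases ?_ (fun j => ?_) i
    · simp [MeasurableEquiv.piFinSuccAbove]
    · simp [MeasurableEquiv.piFinSuccAbove, Fin.tail]

theorem QPoly.ae_ne_zero {d : ℕ} {f : (Fin d → ℂ) → ℂ} (hf : QPoly f) (z : Fin d → ℂ)
    (hz : f z ≠ 0) : ∀ᵐ s : Fin d → ℝ, f (fun i => (s i : ℂ)) ≠ 0 := by
  obtain ⟨q, hq⟩ := hf
  simp only [hq] at *
  refine ae_eval_ne_zero d q ?_
  rintro rfl
  simp at hz

theorem exists_alg_rel {σ ι : Type} [Fintype σ] [Fintype ι]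
    (hc : Fintype.card σ < Fintype.card ι) (f : ι → (σ → ℂ) → ℂ) (hf : ∀ i, QPoly (f i)) :
    ∃ P : MvPolynomial ι ℂ, P ≠ 0 ∧ ∀ z, MvPolynomial.eval (fun i => f i z) P = 0 := by
  choose p hp using hf
  have : ¬ AlgebraicIndependent ℂ p := by
    intro h
    have h1 := h.cardinalMk_le_trdeg
    rw [MvPolynomial.trdeg_of_isDomain] at h1
    simp only [Cardinal.mk_fintype, Cardinal.lift_natCast, Nat.cast_le] at h1
    omega
  rw [algebraicIndependent_iff] at this
  push Not at this
  obtain ⟨P, h1, h2⟩ := this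
  refine ⟨P, h2, fun z => ?_⟩
  have h3 := congrArg (MvPolynomial.eval z) h1
  rw [map_zero] at h3
  rw [← h3]
  simp only [hp]
  rw [← MvPolynomial.coe_aeval_eq_eval z, RingHom.coe_coe, ← MvPolynomial.bind₁, MvPolynomial.aeval_bind₁]
  rw [← MvPolynomial.coe_aeval_eq_eval]
  rfl

end PolyTools

section EmbedTools

abbrev M2 := Matrix (Fin 2) (Fin 2) ℂ
abbrev M4 := Matrix (Fin 4) (Fin 4) ℂ

def hiB (i : Fin 4) : Fin 2 := ⟨i.val / 2, by have := i.isLt; omega⟩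
def loB (i : Fin 4) : Fin 2 := ⟨i.val % 2, by have := i.isLt; omega⟩

theorem hiB_pair (a b : Fin 2) : hiB (pairIdx a b) = a := by
  apply Fin.ext; simp only [hiB, pairIdx]; omega
theorem loB_pair (a b : Fin 2) : loB (pairIdx a b) = b := by
  apply Fin.ext; simp only [loB, pairIdx]; omega
theorem pair_hi_lo (i : Fin 4) : pairIdx (hiB i) (loB i) = i := by
  apply Fin.ext; simp only [hiB, loB, pairIdx]; omega

theorem sum_pair (g : Fin 4 → ℂ) : ∑ i, g i = ∑ α : Fin 2, ∑ β : Fin 2, g (pairIdx α β) := by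
  have h0 : pairIdx 0 0 = 0 := rfl
  have h1 : pairIdx 0 1 = 1 := rfl
  have h2 : pairIdx 1 0 = 2 := rfl
  have h3 : pairIdx 1 1 = 3 := rfl
  simp only [Fin.sum_univ_four, Fin.sum_univ_two, h0, h1, h2, h3]
  ring

/-- Kronecker product of one-qubit matrices -/
def kron2 (a b : M2) : M4 := fun i j => a (hiB i) (hiB j) * b (loB i) (loB j)

theorem kron2_pair (a b : M2) (α β γ δ : Fin 2) :
    kron2 a b (pairIdx α β) (pairIdx γ δ) = a α γ * b β δ := by
  simp only [kron2, hiB_pair, loB_pair]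

theorem kron2_mul (a b c d : M2) : kron2 a b * kron2 c d = kron2 (a * c) (b * d) := by
  ext i j
  rw [Matrix.mul_apply, sum_pair]
  simp only [kron2, hiB_pair, loB_pair, Matrix.mul_apply, Fin.sum_univ_two]
  ring

theorem ext_pair {u v : M4} (h : ∀ α β γ δ, u (pairIdx α β) (pairIdx γ δ) =
    v (pairIdx α β) (pairIdx γ δ)) : u = v := by
  ext i j
  have := h (hiB i) (loB i) (hiB j) (loB j)
  simpa only [pair_hi_lo] using this

theorem pairIdx_inj {α β γ δ : Fin 2} : pairIdx α β = pairIdx γ δ ↔ α = γ ∧ β = δ := by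
  constructor
  · intro h
    exact ⟨by rw [← hiB_pair α β, h, hiB_pair], by rw [← loB_pair α β, h, loB_pair]⟩
  · rintro ⟨rfl, rfl⟩; rfl

theorem kron2_one : kron2 1 1 = 1 := by
  apply ext_pair
  intro α β γ δ
  rw [kron2_pair]
  simp only [Matrix.one_apply, pairIdx_inj]
  split_ifs <;> simp_all

variable {n : ℕ}

def setPair {X : Type} (p : Fin n × Fin n) (a : Fin n → X) (α β : X) : Fin n → X :=
  Function.update (Function.update a p.1 α) p.2 β

theorem setPair_fst {X : Type} {p : Fin n × Fin n} (hp : p.1 ≠ p.2) (a : Fin n → X) (α β : X) :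
    setPair p a α β p.1 = α := by simp [setPair, hp]
theorem setPair_snd {X : Type} (p : Fin n × Fin n) (a : Fin n → X) (α β : X) :
    setPair p a α β p.2 = β := by simp [setPair]
theorem setPair_other {X : Type} {p : Fin n × Fin n} (a : Fin n → X) (α β : X) {i : Fin n}
    (h1 : i ≠ p.1) (h2 : i ≠ p.2) :
    setPair p a α β i = a i := by simp [setPair, h1, h2]
theorem setPair_self {X : Type} (p : Fin n × Fin n) (a : Fin n → X) :
    setPair p a (a p.1) (a p.2) = a := by simp [setPair]

theorem embed_mul_apply {p : Fin n × Fin n} (hp : p.1 ≠ p.2) (u : M4) (M : NMatrix n)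
    (a b : QubitBasis n) : (embedGate p u * M) a b =
      ∑ α : Fin 2, ∑ β : Fin 2, u (pairIdx (a p.1) (a p.2)) (pairIdx α β) *
        M (setPair p a α β) b := by
  rw [Matrix.mul_apply]
  rw [← Fintype.sum_prod_type' (f := fun α β => u (pairIdx (a p.1) (a p.2)) (pairIdx α β) *
        M (setPair p a α β) b)]
  symm
  apply Finset.sum_of_injOn (fun x : Fin 2 × Fin 2 => setPair p a x.1 x.2)
  · rintro ⟨x, y⟩ _ ⟨x', y'⟩ _ h
    have h1 := congrFun h p.1
    have h2 := congrFun h p.2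
    simp only [setPair_fst hp, setPair_snd] at h1 h2
    rw [h1, h2]
  · intro x _; simp
  · intro c _ hc
    have : ¬ (∀ i, i ≠ p.1 → i ≠ p.2 → a i = c i) := by
      intro h
      apply hc
      refine ⟨(c p.1, c p.2), by simp, ?_⟩
      funext i
      by_cases h1 : i = p.1
      · subst h1; simp [setPair_fst hp]
      by_cases h2 : i = p.2
      · subst h2; simp [setPair_snd]
      simp only [setPair_other _ _ _ h1 h2, h i h1 h2]
    simp [embedGate, this]
  · rintro ⟨α, β⟩ _
    have : (∀ i, i ≠ p.1 → i ≠ p.2 → a i = setPair p a α β i) := by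
      intro i h1 h2
      rw [setPair_other _ _ _ h1 h2]
    simp only [embedGate, if_pos this, setPair_fst hp, setPair_snd]

theorem embedGate_mul {p : Fin n × Fin n} (hp : p.1 ≠ p.2) (u v : M4) :
    embedGate p (u * v) = embedGate p u * embedGate p v := by
  ext a b
  rw [embed_mul_apply hp]
  have h : ∀ α β, (∀ i, i ≠ p.1 → i ≠ p.2 → setPair p a α β i = b i) ↔
      (∀ i, i ≠ p.1 → i ≠ p.2 → a i = b i) := by
    intro α β
    refine forall_congr' fun i => forall_congr' fun h1 => forall_congr' fun h2 => ?_
    rw [setPair_other _ _ _ h1 h2]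
  simp only [embedGate, h, setPair_fst hp, setPair_snd]
  split_ifs
  · rw [Matrix.mul_apply, sum_pair]
  · simp

theorem embedGate_one (p : Fin n × Fin n) : embedGate p (1 : M4) = 1 := by
  ext a b
  simp only [embedGate, Matrix.one_apply, pairIdx_inj]
  by_cases hab : a = b
  · subst hab; simp
  · rw [if_neg hab]
    split_ifs with h1 h2
    · exfalso; apply hab
      funext i
      by_cases e1 : i = p.1
      · rw [e1]; exact h2.1
      by_cases e2 : i = p.2
      · rw [e2]; exact h2.2
      exact h1 i e1 e2
    · rfl
    · rfl

theorem embedGate_add (p : Fin n × Fin n) (u v : M4) :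
    embedGate p (u + v) = embedGate p u + embedGate p v := (embedLin p).map_add u v

theorem embedGate_smul (p : Fin n × Fin n) (t : ℂ) (u : M4) :
    embedGate p (t • u) = t • embedGate p u := by
  ext a b
  simp only [embedGate, Matrix.smul_apply]
  split <;> simp

theorem embedGate_transpose (p : Fin n × Fin n) (u : M4) :
    embedGate p uᵀ = (embedGate p u)ᵀ := by
  ext a b
  simp only [embedGate, Matrix.transpose_apply]
  have : (∀ i, i ≠ p.1 → i ≠ p.2 → a i = b i) ↔ (∀ i, i ≠ p.1 → i ≠ p.2 → b i = a i) :=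
    ⟨fun h i h1 h2 => (h i h1 h2).symm, fun h i h1 h2 => (h i h1 h2).symm⟩
  simp only [this]

theorem embedGate_isUnit {p : Fin n × Fin n} (hp : p.1 ≠ p.2) {u : M4} (hu : IsUnit u) :
    IsUnit (embedGate p u) := by
  obtain ⟨w, rfl⟩ := hu
  refine ⟨⟨embedGate p w, embedGate p (↑w⁻¹ : M4), ?_, ?_⟩, rfl⟩
  · rw [← embedGate_mul hp]; simp [embedGate_one]
  · rw [← embedGate_mul hp]; simp [embedGate_one]

/-- tensor product of one-qubit matrices -/
def localOp (c : Fin n → M2) : NMatrix n := fun a b => ∏ i, c i (a i) (b i)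

theorem prod_split {p : Fin n × Fin n} (hp : p.1 ≠ p.2) (g : Fin n → ℂ) :
    ∏ i, g i = g p.1 * g p.2 * ∏ i ∈ (Finset.univ.erase p.1).erase p.2, g i := by
  rw [mul_assoc, Finset.mul_prod_erase _ _ (by simp [Ne.symm hp]),
    Finset.mul_prod_erase _ _ (Finset.mem_univ _)]

theorem localOp_split {p : Fin n × Fin n} (hp : p.1 ≠ p.2) (c : Fin n → M2) (x y : M2)
    (a b : QubitBasis n) (α β : Fin 2) :
    localOp (setPair p c x y) (setPair p a α β) b = x α (b p.1) * y β (b p.2) *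
      ∏ i ∈ (Finset.univ.erase p.1).erase p.2, c i (a i) (b i) := by
  unfold localOp
  rw [prod_split hp]
  simp only [setPair_fst hp, setPair_snd]
  congr 1
  refine Finset.prod_congr rfl fun i hi => ?_
  simp only [Finset.mem_erase] at hi
  rw [setPair_other _ _ _ hi.2.1 hi.1, setPair_other _ _ _ hi.2.1 hi.1]

theorem localOp_split' {p : Fin n × Fin n} (hp : p.1 ≠ p.2) (c : Fin n → M2) (x y : M2)
    (a b : QubitBasis n) :
    localOp (setPair p c x y) a b = x (a p.1) (b p.1) * y (a p.2) (b p.2) *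
      ∏ i ∈ (Finset.univ.erase p.1).erase p.2, c i (a i) (b i) := by
  conv_lhs => rw [← setPair_self p a]
  exact localOp_split hp c x y a b _ _

theorem embed_kron_localOp {p : Fin n × Fin n} (hp : p.1 ≠ p.2) (c : Fin n → M2) (x y : M2) :
    embedGate p (kron2 x y) * localOp (setPair p c 1 1) = localOp (setPair p c x y) := by
  ext a b
  rw [embed_mul_apply hp, localOp_split' hp]
  simp only [localOp_split hp, kron2_pair, Matrix.one_apply]
  simp [Finset.sum_ite_eq, ← mul_assoc]

theorem embed_localOp_apply {p : Fin n × Fin n} (hp : p.1 ≠ p.2) (c : Fin n → M2) (u : M4)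
    (a b : QubitBasis n) :
    (embedGate p u * localOp (setPair p c 1 1)) a b =
      u (pairIdx (a p.1) (a p.2)) (pairIdx (b p.1) (b p.2)) *
      ∏ i ∈ (Finset.univ.erase p.1).erase p.2, c i (a i) (b i) := by
  rw [embed_mul_apply hp]
  simp only [localOp_split hp, Matrix.one_apply]
  simp [Finset.sum_ite_eq, ← mul_assoc]

theorem localOp_transpose (c : Fin n → M2) : (localOp c)ᵀ = localOp (fun i => (c i)ᵀ) := by
  ext a b; rfl

theorem embed_localOp_comm {p : Fin n × Fin n} (hp : p.1 ≠ p.2) (c : Fin n → M2) (u : M4) :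
    embedGate p u * localOp (setPair p c 1 1) = localOp (setPair p c 1 1) * embedGate p u := by
  have h : localOp (setPair p c 1 1) * embedGate p u =
      (embedGate p uᵀ * localOp (setPair p (fun i => (c i)ᵀ) 1 1))ᵀ := by
    rw [Matrix.transpose_mul, localOp_transpose, embedGate_transpose, Matrix.transpose_transpose]
    congr 2
    funext i
    by_cases h1 : i = p.1
    · subst h1; simp [setPair_fst hp]
    by_cases h2 : i = p.2
    · subst h2; simp [setPair_snd]
    simp [setPair_other _ _ _ h1 h2]
  rw [h]
  ext a b
  rw [Matrix.transpose_apply, embed_localOp_apply hp, embed_localOp_apply hp]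
  rfl

theorem localOp_mul_embed {p : Fin n × Fin n} (hp : p.1 ≠ p.2) (c : Fin n → M2) (u : M4) :
    localOp c * embedGate p u =
      embedGate p (kron2 (c p.1) (c p.2) * u) * localOp (setPair p c 1 1) := by
  conv_lhs => rw [← setPair_self p c, ← embed_kron_localOp hp, Matrix.mul_assoc,
    ← embed_localOp_comm hp, ← Matrix.mul_assoc, ← embedGate_mul hp]

theorem localOp_one : localOp (fun _ : Fin n => (1 : M2)) = 1 := by
  ext a b
  simp only [localOp, Matrix.one_apply]
  by_cases h : a = b
  · subst h; simp
  · rw [if_neg h]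
    obtain ⟨i, hi⟩ := Function.ne_iff.1 h
    exact Finset.prod_eq_zero (Finset.mem_univ i) (by simp [hi])

theorem embed_conj_localOp {p : Fin n × Fin n} (hp : p.1 ≠ p.2) (c : Fin n → M2) (u : M4)
    (x y : M2) (h : u * kron2 (c p.1) (c p.2) = kron2 x y * u) :
    embedGate p u * localOp c = localOp (setPair p c x y) * embedGate p u := by
  have h1 : localOp c = embedGate p (kron2 (c p.1) (c p.2)) * localOp (setPair p c 1 1) := by
    rw [embed_kron_localOp hp, setPair_self]
  rw [h1, ← Matrix.mul_assoc, ← embedGate_mul hp, h, embedGate_mul hp, Matrix.mul_assoc,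
    embed_localOp_comm hp, ← Matrix.mul_assoc, embed_kron_localOp hp]

/-- contraction with arbitrary matrices as gates -/
noncomputable def contractM {n : ℕ} : {R : ℕ} → (A : Architecture n R) → (x : Fin R → M4) →
    NMatrix n
  | 0, _, _ => 1
  | R + 1, A, x => embedGate (A (Fin.last R)).1 (x (Fin.last R)) *
      contractM (R := R) (fun i => A i.castSucc) (fun i => x i.castSucc)

theorem contract_eq {n : ℕ} : ∀ {R : ℕ} (A : Architecture n R) (x : Fin R → SU4),
    contract A x = contractM A (fun i => (x i : M4))
  | 0, _, _ => by simp [contract, gateList, contractM]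
  | R + 1, A, x => by
    have := contract_eq (R := R) (fun i => A i.castSucc) (fun i => x i.castSucc)
    simp only [contractM]
    rw [← this]
    simp only [contract, gateList]
    rw [List.ofFn_succ']
    simp

theorem QPolyM.embed {σ : Type} {n : ℕ} (p : Fin n × Fin n) {u : (σ → ℂ) → M4} (hu : QPolyM u) :
    QPolyM (fun z => embedGate p (u z)) := by
  intro a b
  simp only [embedGate]
  split_ifs
  · exact hu _ _
  · exact QPoly.const 0

theorem QPolyM.contractM {σ : Type} {n : ℕ} : ∀ {R : ℕ} (A : Architecture n R)
    {x : (σ → ℂ) → Fin R → M4} (_ : ∀ i, QPolyM (fun z => x z i)),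
    QPolyM (fun z => contractM A (x z))
  | 0, _, _, _ => QPolyM.const 1
  | R + 1, A, x, hx => by
    have := QPolyM.contractM (R := R) (fun i => A i.castSucc) (x := fun z i => x z i.castSucc)
      (fun i => hx _)
    exact QPolyM.mul (QPolyM.embed _ (hx _)) this

theorem QPolyM.localOp {σ : Type} {n : ℕ} {c : (σ → ℂ) → Fin n → M2}
    (hc : ∀ i, QPolyM (fun z => c z i)) : QPolyM (fun z => localOp (c z)) := by
  intro a b
  exact QPoly.prod _ fun i => hc i _ _

theorem contractM_smul {n : ℕ} : ∀ {R : ℕ} (A : Architecture n R) (t : Fin R → ℂ) (x : Fin R → M4),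
    contractM A (fun i => t i • x i) = (∏ i, t i) • contractM A x
  | 0, _, _, _ => by simp [contractM]
  | R + 1, A, t, x => by
    have := contractM_smul (R := R) (fun i => A i.castSucc) (fun i => t i.castSucc)
      (fun i => x i.castSucc)
    simp only [contractM]
    rw [this, embedGate_smul, Fin.prod_univ_castSucc, Matrix.smul_mul, Matrix.mul_smul, smul_smul,
      mul_comm (t (Fin.last R))]

end EmbedTools

section PauliTools

theorem pauli_zero : pauli 0 = 1 := rfl
theorem pauli_sq (k : Fin 4) : pauli k * pauli k = 1 := by
  fin_cases k <;> ext i j <;> fin_cases i <;> fin_cases j <;>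
    simp [pauli, Matrix.mul_apply, Fin.sum_univ_two]
theorem pauli_herm (k : Fin 4) : (pauli k)ᴴ = pauli k := by
  fin_cases k <;> ext i j <;> fin_cases i <;> fin_cases j <;>
    simp [pauli, Matrix.conjTranspose_apply]
theorem pauli_anti (k l : Fin 4) (hk : k ≠ 0) (hl : l ≠ 0) (hkl : k ≠ l) :
    pauli k * pauli l = - (pauli l * pauli k) := by
  fin_cases k <;> fin_cases l <;> first
    | (exfalso; simp_all; done)
    | (ext i j; fin_cases i <;> fin_cases j <;>
        simp [pauli, Matrix.mul_apply, Fin.sum_univ_two])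

theorem pauli_expand (M : M2) : ∃ t : Fin 4 → ℂ, M = ∑ k, t k • pauli k := by
  refine ⟨![(M 0 0 + M 1 1) / 2, (M 0 1 + M 1 0) / 2, (M 0 1 - M 1 0) / 2 * Complex.I,
    (M 0 0 - M 1 1) / 2], ?_⟩
  have hI := Complex.I_mul_I
  ext i j
  fin_cases i <;> fin_cases j <;>
    simp [pauli, Matrix.sum_apply, Fin.sum_univ_four] <;> (try ring_nf) <;>
    (try simp [Complex.I_sq]) <;> ring

theorem kron2_sum_sum (s t : Fin 4 → ℂ) (f g : Fin 4 → M2) :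
    kron2 (∑ k, s k • f k) (∑ l, t l • g l) = ∑ k, ∑ l, (s k * t l) • kron2 (f k) (g l) := by
  ext i j
  simp only [kron2, Matrix.sum_apply, Matrix.smul_apply, Finset.sum_mul_sum, smul_eq_mul]
  refine Finset.sum_congr rfl fun k _ => Finset.sum_congr rfl fun l _ => ?_
  ring

theorem span_kron_pauli :
    Submodule.span ℂ (Set.range fun k : Fin 4 × Fin 4 => kron2 (pauli k.1) (pauli k.2)) = ⊤ := by
  rw [eq_top_iff]
  rintro M -
  have hk : ∀ x y : M2, kron2 x y ∈
      Submodule.span ℂ (Set.range fun k : Fin 4 × Fin 4 => kron2 (pauli k.1) (pauli k.2)) := by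
    intro x y
    obtain ⟨s, hs⟩ := pauli_expand x
    obtain ⟨t, ht⟩ := pauli_expand y
    rw [hs, ht, kron2_sum_sum]
    exact Submodule.sum_mem _ fun k _ => Submodule.sum_mem _ fun l _ =>
      Submodule.smul_mem _ _ (Submodule.subset_span ⟨(k, l), rfl⟩)
  rw [Matrix.matrix_eq_sum_single M]
  refine Submodule.sum_mem _ fun i _ => Submodule.sum_mem _ fun j _ => ?_
  have : Matrix.single i j (M i j) = M i j • kron2 (Matrix.single (hiB i) (hiB j) 1)
      (Matrix.single (loB i) (loB j) 1) := by
    rw [← pair_hi_lo i, ← pair_hi_lo j]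
    apply ext_pair
    intro α β γ δ
    simp only [hiB_pair, loB_pair, Matrix.smul_apply, kron2_pair, Matrix.single_apply, pairIdx_inj]
    split_ifs <;> simp_all
  rw [this]
  exact Submodule.smul_mem _ _ (hk _ _)

theorem span_localOp (n : ℕ) :
    Submodule.span ℂ (Set.range fun f : Fin n → Fin 4 => localOp (fun i => pauli (f i))) = ⊤ := by
  rw [eq_top_iff]
  rintro M -
  rw [Matrix.matrix_eq_sum_single M]
  refine Submodule.sum_mem _ fun a _ => Submodule.sum_mem _ fun b _ => ?_
  have h1 : Matrix.single a b (M a b) = M a b •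
      localOp (fun i => Matrix.single (a i) (b i) (1 : ℂ)) := by
    ext x y
    simp only [Matrix.smul_apply, localOp, Matrix.single_apply, smul_eq_mul]
    by_cases h : a = x ∧ b = y
    · obtain ⟨rfl, rfl⟩ := h
      simp
    · rw [if_neg h]
      have : ∃ i, ¬ (a i = x i ∧ b i = y i) := by
        by_contra hc
        push Not at hc
        exact h ⟨funext fun i => (hc i).1, funext fun i => (hc i).2⟩
      obtain ⟨i, hi⟩ := this
      rw [Finset.prod_eq_zero (Finset.mem_univ i) (by rw [if_neg hi]), mul_zero]
  rw [h1]
  refine Submodule.smul_mem _ _ ?_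
  choose t ht using fun i => pauli_expand (Matrix.single (a i) (b i) (1 : ℂ))
  have h2 : localOp (fun i => Matrix.single (a i) (b i) (1 : ℂ)) =
      ∑ f : Fin n → Fin 4, (∏ i, t i (f i)) • localOp (fun i => pauli (f i)) := by
    ext x y
    simp only [localOp, Matrix.sum_apply, Matrix.smul_apply, smul_eq_mul, ← Finset.prod_mul_distrib]
    rw [← Fintype.piFinset_univ, ← Finset.prod_univ_sum (f := fun i k => t i k * pauli k (x i) (y i))]
    refine Finset.prod_congr rfl fun i _ => ?_
    rw [ht i]
    simp [Matrix.sum_apply]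
  rw [h2]
  exact Submodule.sum_mem _ fun f _ => Submodule.smul_mem _ _ (Submodule.subset_span ⟨f, rfl⟩)

def swap4 : M4 := !![1,0,0,0;0,0,1,0;0,1,0,0;0,0,0,1]

theorem kron2_neg_right (x y : M2) : kron2 x (-y) = - kron2 x y := by
  ext i j; simp [kron2]

theorem exists_intertwiner (a b : Fin 4) : ∃ u : M4, IsUnit u ∧ ∃ c : Fin 4,
    (a ≠ 0 ∨ b ≠ 0 → c ≠ 0) ∧
    u * kron2 (pauli a) (pauli b) = kron2 1 (pauli c) * u := by
  by_cases hb : b = 0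
  · subst hb
    have hs : swap4 * swap4 = 1 := by
      ext i j; fin_cases i <;> fin_cases j <;> simp [swap4, Matrix.mul_apply, Fin.sum_univ_four]
    refine ⟨swap4, ⟨⟨swap4, swap4, hs, hs⟩, rfl⟩, a, by simp, ?_⟩
    rw [pauli_zero]
    generalize pauli a = x
    ext i j
    fin_cases i <;> fin_cases j <;>
      simp [swap4, Matrix.mul_apply, Fin.sum_univ_four, kron2, hiB, loB, Matrix.one_apply]
  · have hc : ∃ c : Fin 4, c ≠ 0 ∧ c ≠ b := by
      revert b; decide
    obtain ⟨c, hc0, hcb⟩ := hc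
    set K := kron2 (pauli a) (pauli b) with hK
    set Z := kron2 1 (pauli c) with hZ
    have hKK : K * K = 1 := by rw [hK, kron2_mul, pauli_sq, pauli_sq, kron2_one]
    have hZZ : Z * Z = 1 := by rw [hZ, kron2_mul, pauli_sq, mul_one, kron2_one]
    have hZK : K * Z = - (Z * K) := by
      rw [hK, hZ, kron2_mul, kron2_mul, mul_one, one_mul,
        pauli_anti b c hb hc0 (Ne.symm hcb), kron2_neg_right]
    have hinv : (1 + Z * K) * (1 - Z * K) = (2 : ℂ) • 1 := by
      have : Z * K * (Z * K) = -1 := by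
        calc Z * K * (Z * K) = Z * (K * Z) * K := by noncomm_ring
          _ = - ((Z * Z) * (K * K)) := by rw [hZK]; noncomm_ring
          _ = -1 := by rw [hZZ, hKK]; simp
      calc (1 + Z * K) * (1 - Z * K) = 1 - Z * K * (Z * K) := by noncomm_ring
        _ = (2 : ℂ) • 1 := by rw [this, two_smul]; abel
    refine ⟨1 + Z * K, ?_, c, fun _ => hc0, ?_⟩
    · apply IsUnit.of_mul_eq_one ((1/2 : ℂ) • (1 - Z * K))
      rw [Matrix.mul_smul, hinv, smul_smul]
      norm_num
    · rw [add_mul, mul_add, mul_assoc, hKK, ← mul_assoc, hZZ]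
      simp [add_comm]
      exact hZ

theorem kron2_herm (x y : M2) : (kron2 x y)ᴴ = kron2 xᴴ yᴴ := by
  ext i j; simp [kron2, Matrix.conjTranspose_apply]

theorem det_one_add (s : ℂ) (a b : Fin 4) (h : a ≠ 0 ∨ b ≠ 0) :
    (1 + (Complex.I * s) • kron2 (pauli a) (pauli b)).det = (1 + s ^ 2) ^ 2 := by
  obtain ⟨u, hu, c, hc, hcomm⟩ := exists_intertwiner a b
  have hc := hc h
  have h1 : (1 + (Complex.I * s) • kron2 (pauli a) (pauli b)).det =
      (1 + (Complex.I * s) • kron2 1 (pauli c)).det := by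
    have hdu : u.det ≠ 0 := ((Matrix.isUnit_iff_isUnit_det u).1 hu).ne_zero
    apply mul_left_cancel₀ hdu
    rw [← Matrix.det_mul, mul_comm u.det, ← Matrix.det_mul]
    congr 1
    rw [mul_add, add_mul, Matrix.mul_smul, Matrix.smul_mul, hcomm]
    simp
  rw [h1]
  have hI : Complex.I ^ 2 = -1 := Complex.I_sq
  have hI4 : Complex.I ^ 4 = 1 := Complex.I_pow_four
  have hI8 : Complex.I ^ 8 = 1 := by rw [show 8 = 4 * 2 from rfl, pow_mul, hI4, one_pow]
  have hI6 : Complex.I ^ 6 = -1 := by rw [show 6 = 2 * 3 from rfl, pow_mul, hI]; norm_num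
  fin_cases c
  · exact absurd rfl hc
  all_goals
    simp [Matrix.det_succ_row_zero, Fin.sum_univ_succ, kron2, hiB, loB, pauli, Fin.succAbove,
      Matrix.one_apply]
    try ring_nf
    try simp only [hI, hI4, hI6, hI8]
    try ring_nf
end PauliTools

section Gauge
open Topology

noncomputable def mMat (m : Fin 3 × Fin 3 → ℂ) : M4 :=
  1 + ∑ k, m k • kron2 (pauli k.1.succ) (pauli k.2.succ)

noncomputable def aMat (z : Fin 4 × Fin 4 → ℂ) : M2 := 1 + ∑ k, z (k, 0) • pauli k
noncomputable def bMat (z : Fin 4 × Fin 4 → ℂ) : M2 :=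
  1 + ∑ k : Fin 3, z (0, k.succ) • pauli k.succ

theorem kron2_add_left (a b c : M2) : kron2 (a + b) c = kron2 a c + kron2 b c := by
  ext i j; simp [kron2, add_mul]
theorem kron2_add_right (a b c : M2) : kron2 c (a + b) = kron2 c a + kron2 c b := by
  ext i j; simp [kron2, mul_add]
theorem kron2_smul_left (t : ℂ) (a c : M2) : kron2 (t • a) c = t • kron2 a c := by
  ext i j; simp [kron2, mul_assoc]
theorem kron2_smul_right (t : ℂ) (a c : M2) : kron2 a (t • c) = t • kron2 a c := by
  ext i j; simp [kron2]; ring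

theorem QPolyM.kron2 {σ : Type} {a b : (σ → ℂ) → M2} (ha : QPolyM a) (hb : QPolyM b) :
    QPolyM (fun z => kron2 (a z) (b z)) := fun _ _ => (ha _ _).mul (hb _ _)

theorem gauge_local (V : Set (M2 × M2)) (hV : V ∈ 𝓝 ((1, 1) : M2 × M2)) :
    ∀ᶠ w in 𝓝 (1 : M4), ∃ m, ∃ a b, (a, b) ∈ V ∧ w = mMat m * kron2 a b := by
  set f : (Fin 4 × Fin 4 → ℂ) → M4 := fun z =>
    mMat (fun k => z (k.1.succ, k.2.succ)) * kron2 (aMat z) (bMat z) with hf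
  have hf0 : f 0 = 1 := by simp [hf, mMat, aMat, bMat, kron2_one]
  have hmap : Filter.map f (𝓝 0) = 𝓝 (f 0) := by
    refine open_of_affine_mat f 0 ?_ (fun k => kron2 (pauli k.1) (pauli k.2)) ?_ span_kron_pauli
    · refine QPolyM.mul ?_ (QPolyM.kron2 ?_ ?_)
      · exact (QPolyM.const 1).add (QPolyM.sum _ fun k => QPolyM.smul (QPoly.coord _) (QPolyM.const _))
      · exact (QPolyM.const 1).add (QPolyM.sum _ fun k => QPolyM.smul (QPoly.coord _) (QPolyM.const _))
      · exact (QPolyM.const 1).add (QPolyM.sum _ fun k => QPolyM.smul (QPoly.coord _) (QPolyM.const _))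
    · rintro ⟨i, j⟩ t
      rw [hf0, zero_add]
      have key : ∀ (inst : DecidableEq (Fin 4 × Fin 4)) (x y : Fin 4),
          (t • (@Pi.single _ (fun _ => ℂ) _ inst (i, j) 1 : Fin 4 × Fin 4 → ℂ)) (x, y) =
          if x = i then (if y = j then t else 0) else 0 := by
        intro _ x y
        simp only [Pi.smul_apply, Pi.single_apply, smul_eq_mul, Prod.mk.injEq]
        by_cases h1 : x = i <;> by_cases h2 : y = j <;> simp [h1, h2]
      simp only [hf, mMat, aMat, bMat, key, Fintype.sum_prod_type]
      refine Fin.cases ?_ (fun i => ?_) i <;> refine Fin.cases ?_ (fun j => ?_) j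
      · simp [Fin.succ_ne_zero, ite_smul, kron2_add_left, kron2_smul_left, kron2_one, pauli_zero]
      · simp [Fin.succ_ne_zero, ite_smul, kron2_add_right, kron2_smul_right, kron2_one, pauli_zero]
        rw [if_neg (Fin.succ_ne_zero j).symm, add_zero, kron2_one]
      · simp [Fin.succ_ne_zero, ite_smul, kron2_add_left, kron2_smul_left, kron2_one, pauli_zero]
      · simp [Fin.succ_ne_zero, ite_smul, kron2_one]
        rw [if_neg (Fin.succ_ne_zero j).symm, if_neg (Fin.succ_ne_zero i).symm, add_zero,
          kron2_one, mul_one]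
  have hcont : Continuous fun z => (aMat z, bMat z) := by
    unfold aMat bMat
    fun_prop
  have h1 : {z | (aMat z, bMat z) ∈ V} ∈ 𝓝 (0 : Fin 4 × Fin 4 → ℂ) := by
    apply hcont.continuousAt.preimage_mem_nhds
    simpa [aMat, bMat] using hV
  have h2 := Filter.image_mem_map (m := f) h1
  rw [hmap, hf0] at h2
  filter_upwards [h2]
  rintro w ⟨z, hz, rfl⟩
  exact ⟨_, _, _, hz, rfl⟩

theorem gauge_contract {n : ℕ} : ∀ {R : ℕ} (A : Architecture n R) (V : Set (Fin n → M2))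
    (_ : V ∈ 𝓝 (1 : Fin n → M2)),
    ∀ᶠ cg in 𝓝 ((1, 1) : (Fin n → M2) × (Fin R → M4)),
      ∃ m : Fin R → Fin 3 × Fin 3 → ℂ, ∃ c' ∈ V,
        localOp cg.1 * contractM A cg.2 = contractM A (fun j => mMat (m j)) * localOp c' := by
  intro R
  induction R with
  | zero =>
    intro A V hV
    have : ∀ᶠ cg in 𝓝 ((1, 1) : (Fin n → M2) × (Fin 0 → M4)), cg.1 ∈ V :=
      continuous_fst.continuousAt.preimage_mem_nhds hV
    filter_upwards [this] with cg hcg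
    exact ⟨fun _ _ => 0, cg.1, hcg, by simp [contractM]⟩
  | succ R ih =>
    intro A V hV
    have hW := ih (fun i => A i.castSucc) V hV
    set p := (A (Fin.last R)).1 with hpd
    have hp : p.1 ≠ p.2 := (A (Fin.last R)).2
    let G : ((Fin n → M2) × (Fin (R + 1) → M4)) × (M2 × M2) → (Fin n → M2) × (Fin R → M4) :=
      fun q => (setPair p q.1.1 q.2.1 q.2.2, fun i => q.1.2 i.castSucc)
    have hG : Continuous G := by
      refine Continuous.prodMk ?_ (by fun_prop)
      unfold setPair
      exact (Continuous.update (by fun_prop) _ (by fun_prop)).update _ (by fun_prop)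
    have hG1 : G ((1, 1), (1, 1)) = (1, 1) := by
      simp only [G]
      refine Prod.ext ?_ rfl
      exact setPair_self p (1 : Fin n → M2)
    have h1 : ∀ᶠ q in 𝓝 (((1, 1), (1, 1)) :
        ((Fin n → M2) × (Fin (R + 1) → M4)) × (M2 × M2)), ∃ m : Fin R → Fin 3 × Fin 3 → ℂ, ∃ c' ∈ V,
        localOp (G q).1 * contractM (fun i => A i.castSucc) (G q).2 =
          contractM (fun i => A i.castSucc) (fun j => mMat (m j)) * localOp c' := by
      have := hG.tendsto ((1, 1), (1, 1))
      rw [hG1] at this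
      exact this.eventually hW
    rw [nhds_prod_eq, Filter.eventually_prod_iff] at h1
    obtain ⟨p1, hp1, p2, hp2, h12⟩ := h1
    have h3 := gauge_local {ab | p2 ab} hp2
    have h4 : Continuous fun cg : (Fin n → M2) × (Fin (R + 1) → M4) =>
        kron2 (cg.1 p.1) (cg.1 p.2) * cg.2 (Fin.last R) := by
      refine Continuous.matrix_mul ?_ (by fun_prop)
      refine continuous_pi fun i => continuous_pi fun j => ?_
      unfold kron2
      fun_prop
    have h5 := h4.tendsto ((1, 1) : (Fin n → M2) × (Fin (R + 1) → M4))
    simp only [Pi.one_apply, kron2_one, mul_one] at h5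
    filter_upwards [hp1, h5.eventually h3] with cg hcg hw
    obtain ⟨m0, a, b, hab, hw⟩ := hw
    obtain ⟨m, c', hc', hm⟩ := h12 hcg hab
    refine ⟨Fin.snoc (α := fun _ => Fin 3 × Fin 3 → ℂ) m m0, c', hc', ?_⟩
    simp only [contractM, Fin.snoc_last, Fin.snoc_castSucc]
    rw [← Matrix.mul_assoc, localOp_mul_embed hp, hw, embedGate_mul hp, Matrix.mul_assoc _ _ (localOp _),
      embed_kron_localOp hp, Matrix.mul_assoc, Matrix.mul_assoc]
    rw [← hm]

theorem localOp_smul {n : ℕ} (t : Fin n → ℂ) (c : Fin n → M2) :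
    localOp (fun q => t q • c q) = (∏ q, t q) • localOp c := by
  ext a b
  simp [localOp, Finset.prod_mul_distrib]

theorem upper_rel {n R : ℕ} (hn : 0 < n) (A : Architecture n R) {ι : Type} [Fintype ι]
    (hc : 9 * R + 3 * n + 1 < Fintype.card ι) (l : NMatrix n →ₗ[ℂ] (ι → ℂ)) :
    ∃ P : MvPolynomial ι ℂ, P ≠ 0 ∧ ∀ (g : Fin R → M4) (c : ℂ),
      MvPolynomial.eval (l (c • contractM A g)) P = 0 := by
  let σ := (Fin R × (Fin 3 × Fin 3)) ⊕ (Fin n × Fin 3) ⊕ Unit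
  let Y : (σ → ℂ) → Fin n → M2 := fun z q =>
    !![1, z (.inr (.inl (q, 0))); z (.inr (.inl (q, 1))), z (.inr (.inl (q, 2)))]
  let Φ : (σ → ℂ) → NMatrix n := fun z => z (.inr (.inr ())) •
    (contractM A (fun j => mMat (fun k => z (.inl (j, k)))) * localOp (Y z))
  have hΦ : QPolyM Φ := by
    refine QPolyM.smul (QPoly.coord _) ((QPolyM.contractM A fun i => ?_).mul (QPolyM.localOp fun i => ?_))
    · exact (QPolyM.const 1).add (QPolyM.sum _ fun k => QPolyM.smul (QPoly.coord _) (QPolyM.const _))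
    · intro a b
      fin_cases a <;> fin_cases b
      · exact QPoly.const 1
      · exact QPoly.coord _
      · exact QPoly.coord _
      · exact QPoly.coord _
  obtain ⟨P, hP0, hP⟩ := exists_alg_rel (σ := σ) (ι := ι) (by simp [σ]; omega)
    (fun i z => l (Φ z) i) (fun i => hΦ.linear l i)
  refine ⟨P, hP0, ?_⟩
  have hev : ∀ᶠ cg in 𝓝 ((1, 1) : (Fin n → M2) × (Fin R → M4)),
      MvPolynomial.eval (l (localOp cg.1 * contractM A cg.2)) P = 0 := by
    have hV : {c : Fin n → M2 | ∀ q, c q 0 0 ≠ 0} ∈ 𝓝 (1 : Fin n → M2) := by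
      show ∀ᶠ c in 𝓝 (1 : Fin n → M2), ∀ q, c q 0 0 ≠ 0
      rw [Filter.eventually_all]
      intro q
      have hc : Continuous fun c : Fin n → M2 => c q 0 0 := by fun_prop
      exact (hc.tendsto 1).eventually_ne (by simp)
    filter_upwards [gauge_contract A _ hV] with cg hcg
    obtain ⟨m, c', hc', h⟩ := hcg
    rw [h]
    set Z : σ → ℂ := Sum.elim (fun jk => m jk.1 jk.2) (Sum.elim
      (fun qi => (c' qi.1 0 0)⁻¹ * ![c' qi.1 0 1, c' qi.1 1 0, c' qi.1 1 1] qi.2)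
      (fun _ => ∏ q, c' q 0 0)) with hZ
    have hcc : (fun q => c' q 0 0 • Y Z q) = c' := by
      funext q
      have := hc' q
      ext a b
      fin_cases a <;> fin_cases b <;> simp [Y, hZ, this]
    have hΦZ : Φ Z = contractM A (fun j => mMat (m j)) * localOp c' := by
      have : Φ Z = (∏ q, c' q 0 0) • (contractM A (fun j => mMat (m j)) * localOp (Y Z)) := rfl
      rw [this, ← Matrix.mul_smul, ← localOp_smul, hcc]
    rw [← hΦZ]
    exact hP Z
  intro g c
  let q0 : Fin n := ⟨0, hn⟩
  let G : (Option (Fin R × Fin 4 × Fin 4) → ℂ) → (Fin R → M4) :=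
    fun z j a b => z (some (j, a, b))
  have hq : QPoly (fun z : Option (Fin R × Fin 4 × Fin 4) → ℂ =>
      MvPolynomial.eval (l (z none • contractM A (G z))) P) := by
    refine QPoly.comp P (f := fun i z => l (z none • contractM A (G z)) i) fun i => ?_
    refine QPolyM.linear ?_ l i
    exact QPolyM.smul (QPoly.coord _) (QPolyM.contractM A fun i a b => QPoly.coord _)
  have hup : ∀ t : ℂ, localOp (Function.update (1 : Fin n → M2) q0 (t • 1)) = t • 1 := by
    intro t
    have : Function.update (1 : Fin n → M2) q0 (t • 1) =
        fun q => (if q = q0 then t else 1) • (1 : M2) := by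
      funext q
      by_cases h : q = q0
      · subst h; simp
      · simp [h]
    rw [this, localOp_smul, localOp_one]
    simp
  have := hq.zero_of_eventually (fun k => k.elim 1 fun k => (1 : M4) k.2.1 k.2.2) ?_
    (fun k => k.elim c fun k => g k.1 k.2.1 k.2.2)
  · exact this
  · let H : (Option (Fin R × Fin 4 × Fin 4) → ℂ) → (Fin n → M2) × (Fin R → M4) :=
      fun z => (Function.update 1 q0 (z none • 1), G z)
    have hH : Continuous H := by
      refine Continuous.prodMk ?_ ?_
      · exact continuous_const.update _ (by fun_prop)
      · refine continuous_pi fun j => continuous_pi fun a => continuous_pi fun b => ?_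
        exact continuous_apply _
    have hH1 := hH.tendsto (fun k => k.elim 1 fun k => (1 : M4) k.2.1 k.2.2)
    have hH2 : H (fun k => k.elim 1 fun k => (1 : M4) k.2.1 k.2.2) = (1, 1) := by
      refine Prod.ext ?_ rfl
      simp only [H, Option.elim_none, one_smul]
      exact Function.update_eq_self q0 (1 : Fin n → M2)
    rw [hH2] at hH1
    filter_upwards [hH1.eventually hev] with z hz
    simpa only [H, hup, Matrix.smul_mul, one_mul] using hz
end Gauge

section Staircase
open Topology
variable {n : ℕ}

def stPair (hn : 2 ≤ n) (r : ℕ) : Fin n × Fin n :=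
  (⟨r % (n - 1), by have := Nat.mod_lt r (y := n - 1) (by omega); omega⟩,
    ⟨r % (n - 1) + 1, by have := Nat.mod_lt r (y := n - 1) (by omega); omega⟩)

theorem stPair_ne (hn : 2 ≤ n) (r : ℕ) : (stPair hn r).1 ≠ (stPair hn r).2 := by
  simp [stPair, Fin.ext_iff]

noncomputable def stC (hn : 2 ≤ n) (x : ℕ → M4) : ℕ → NMatrix n
  | 0 => 1
  | r + 1 => embedGate (stPair hn r) (x r) * stC hn x r

theorem stC_eq (hn : 2 ≤ n) (x : ℕ → M4) : ∀ (R : ℕ) (A : Architecture n R)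
    (_ : ∀ i, (A i).1 = stPair hn i), contractM A (fun i => x i) = stC hn x R
  | 0, _, _ => rfl
  | R + 1, A, hA => by
    have := stC_eq hn x R (fun i => A i.castSucc) (fun i => hA i.castSucc)
    simp only [contractM, stC]
    rw [← this, hA]
    rfl

theorem stC_congr (hn : 2 ≤ n) {x y : ℕ → M4} : ∀ (R : ℕ), (∀ r < R, x r = y r) →
    stC hn x R = stC hn y R
  | 0, _ => rfl
  | R + 1, h => by
    simp only [stC]
    rw [h R (by omega), stC_congr hn R fun r hr => h r (by omega)]

theorem stC_isUnit (hn : 2 ≤ n) {x : ℕ → M4} (hx : ∀ r, IsUnit (x r)) : ∀ R, IsUnit (stC hn x R)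
  | 0 => isUnit_one
  | R + 1 => (embedGate_isUnit (stPair_ne hn R) (hx R)).mul (stC_isUnit hn hx R)

theorem stC_update (hn : 2 ≤ n) (x : ℕ → M4) (r : ℕ) (E : M4) (D : NMatrix n) (t : ℂ)
    (h : embedGate (stPair hn r) E * stC hn x (r + 1) = stC hn x (r + 1) * D) (N : ℕ)
    (hN : r + 1 ≤ N) :
    stC hn (Function.update x r ((1 + t • E) * x r)) N = stC hn x N + t • (stC hn x N * D) := by
  induction N, hN using Nat.le_induction with
  | base =>
    rw [← h]
    simp only [stC, Function.update_self]
    rw [stC_congr hn (y := x) r fun r' hr' => by rw [Function.update_of_ne (by omega)]]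
    rw [embedGate_mul (stPair_ne hn r), embedGate_add, embedGate_one, embedGate_smul]
    simp only [add_mul, one_mul, Matrix.smul_mul, Matrix.mul_assoc]
  | succ N hN ih =>
    have h1 : Function.update x r ((1 + t • E) * x r) N = x N :=
      Function.update_of_ne (by omega) _ _
    rw [stC, h1, ih, stC]
    rw [mul_add, Matrix.mul_smul, Matrix.mul_assoc]

theorem block_step (hn : 2 ≤ n) (s : ℕ) (x : ℕ → M4) (hx : ∀ r, IsUnit (x r)) (f : Fin n → Fin 4)
    (D : NMatrix n)
    (hD : stC hn x (s * (n - 1)) * D = localOp (fun i => pauli (f i)) * stC hn x (s * (n - 1))) :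
    ∀ k ≤ n - 1, ∃ y : ℕ → M4, (∀ r < s * (n - 1), y r = x r) ∧ (∀ r, IsUnit (y r)) ∧
      ∃ f' : Fin n → Fin 4, (∀ i : Fin n, (i : ℕ) < k → f' i = 0) ∧
        stC hn y (s * (n - 1) + k) * D =
          localOp (fun i => pauli (f' i)) * stC hn y (s * (n - 1) + k) := by
  intro k
  induction k with
  | zero => exact fun _ => ⟨x, fun _ _ => rfl, hx, f, by simp, hD⟩
  | succ k ih =>
    intro hk
    obtain ⟨y, hy, hyu, f', hf', hyD⟩ := ih (by omega)
    set r := s * (n - 1) + k with hr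
    set p := stPair hn r with hpdef
    have hp : p.1 ≠ p.2 := stPair_ne hn r
    have hmod : r % (n - 1) = k := by
      rw [hr]; exact Nat.mul_add_mod_of_lt (by omega)
    have hp1 : (p.1 : ℕ) = k := hmod
    have hp2 : (p.2 : ℕ) = k + 1 := by rw [← hmod]; rfl
    obtain ⟨u, hu, c, -, huc⟩ := exists_intertwiner (f' p.1) (f' p.2)
    have hpre : stC hn (Function.update y r u) r = stC hn y r :=
      stC_congr hn r fun r' hr' => by rw [Function.update_of_ne (by omega)]
    refine ⟨Function.update y r u, ?_, ?_, setPair p f' 0 c, ?_, ?_⟩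
    · intro r' hr'
      rw [Function.update_of_ne (by omega), hy r' hr']
    · intro r'
      by_cases h : r' = r
      · subst h; simpa using hu
      · rw [Function.update_of_ne h]; exact hyu r'
    · intro i hi
      by_cases h : i = p.1
      · rw [h, setPair_fst hp]
      · have h2 : i ≠ p.2 := by
          intro h2; rw [h2] at hi; omega
        rw [setPair_other _ _ _ h h2]
        apply hf'
        have : (i : ℕ) ≠ k := fun h' => h (Fin.ext (by omega))
        omega
    · have hset : (fun i => pauli (setPair p f' 0 c i)) =
          setPair p (fun i => pauli (f' i)) 1 (pauli c) := by
        funext i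
        by_cases h2 : i = p.2
        · rw [h2, setPair_snd, setPair_snd]
        · by_cases h1 : i = p.1
          · rw [h1, setPair_fst hp, setPair_fst hp, pauli_zero]
          · rw [setPair_other _ _ _ h1 h2, setPair_other _ _ _ h1 h2]
      have e : s * (n - 1) + (k + 1) = r + 1 := by omega
      rw [e, stC, Function.update_self, hpre, Matrix.mul_assoc, hyD, ← Matrix.mul_assoc, hset,
        ← Matrix.mul_assoc]
      rw [embed_conj_localOp hp (fun i => pauli (f' i)) u 1 (pauli c) huc]

theorem block_full (hn : 2 ≤ n) (s : ℕ) (x : ℕ → M4) (hx : ∀ r, IsUnit (x r)) (f : Fin n → Fin 4)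
    (D : NMatrix n)
    (hD : stC hn x (s * (n - 1)) * D = localOp (fun i => pauli (f i)) * stC hn x (s * (n - 1))) :
    ∃ y : ℕ → M4, (∀ r < s * (n - 1), y r = x r) ∧ (∀ r, IsUnit (y r)) ∧
      ∃ c : Fin 4, embedGate (stPair hn (s * (n - 1) + (n - 2))) (kron2 1 (pauli c)) *
        stC hn y (s * (n - 1) + (n - 2) + 1) = stC hn y (s * (n - 1) + (n - 2) + 1) * D := by
  obtain ⟨y, hy, hyu, f', hf', h⟩ := block_step hn s x hx f D hD (n - 1) le_rfl
  have e : s * (n - 1) + (n - 2) + 1 = s * (n - 1) + (n - 1) := by omega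
  rw [e]
  set r := s * (n - 1) + (n - 2) with hr
  have hp := stPair_ne hn r
  have hmod : r % (n - 1) = n - 2 := by
      rw [hr]; exact Nat.mul_add_mod_of_lt (by omega)
  have hp2 : ((stPair hn r).2 : ℕ) = n - 2 + 1 := by rw [← hmod]; rfl
  refine ⟨y, hy, hyu, f' (stPair hn r).2, ?_⟩
  rw [h]
  congr 1
  have h1 := embed_kron_localOp hp (fun _ => (1 : M2)) 1 (pauli (f' (stPair hn r).2))
  have h2 : setPair (stPair hn r) (fun _ => (1 : M2)) 1 1 = fun _ => 1 :=
    setPair_self (stPair hn r) (fun _ => (1 : M2))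
  rw [h2, localOp_one, mul_one] at h1
  rw [h1]
  congr 1
  funext i
  by_cases hi : i = (stPair hn r).2
  · rw [hi, setPair_snd]
  · have hi' : (i : ℕ) < n - 1 := by
      have := i.isLt
      have : (i : ℕ) ≠ n - 2 + 1 := fun h' => hi (Fin.ext (by omega))
      omega
    rw [hf' i hi', pauli_zero]
    by_cases h1 : i = (stPair hn r).1
    · rw [h1, setPair_fst hp]
    · rw [setPair_other _ _ _ h1 hi]

theorem exists_new (W : NMatrix n) (hW : IsUnit W) {k : ℕ} (v : Fin k → NMatrix n)
    (hk : k < 4 ^ n) : ∃ (f : Fin n → Fin 4) (D : NMatrix n),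
      W * D = localOp (fun i => pauli (f i)) * W ∧ D ∉ Submodule.span ℂ (Set.range v) := by
  obtain ⟨w, rfl⟩ := hW
  by_contra hcon
  push Not at hcon
  set S := Submodule.span ℂ (Set.range v) with hS
  have h1 : ∀ f : Fin n → Fin 4, (↑w⁻¹ : NMatrix n) * localOp (fun i => pauli (f i)) * w ∈ S := by
    intro f
    apply hcon f
    rw [← Matrix.mul_assoc, ← Matrix.mul_assoc, Units.mul_inv, one_mul]
  let φ : NMatrix n →ₗ[ℂ] NMatrix n :=
    (LinearMap.mulLeft ℂ (↑w⁻¹ : NMatrix n)) ∘ₗ (LinearMap.mulRight ℂ (w : NMatrix n))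
  have h2 : (⊤ : Submodule ℂ (NMatrix n)) ≤ S.comap φ := by
    rw [← span_localOp, Submodule.span_le]
    rintro _ ⟨f, rfl⟩
    have := h1 f
    rw [Matrix.mul_assoc] at this
    exact this
  have h3 : S = ⊤ := by
    rw [eq_top_iff]
    intro M _
    have := h2 (Submodule.mem_top (x := (w : NMatrix n) * M * (↑w⁻¹ : NMatrix n)))
    have e : φ ((w : NMatrix n) * M * (↑w⁻¹ : NMatrix n)) = M := by
      simp only [φ, LinearMap.comp_apply, LinearMap.mulLeft_apply, LinearMap.mulRight_apply]
      rw [Matrix.mul_assoc (_ * M), Units.inv_mul, mul_one, ← Matrix.mul_assoc, Units.inv_mul,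
        one_mul]
    rw [Submodule.mem_comap, e] at this
    exact this
  have h4 : Module.finrank ℂ S ≤ k := by
    have := finrank_range_le_card (R := ℂ) v
    simpa [Set.finrank] using this
  rw [h3, finrank_top, Module.finrank_matrix] at h4
  simp [← mul_pow] at h4
  omega

theorem rank_ind (hn : 2 ≤ n) : ∀ T : ℕ, T + 1 ≤ 4 ^ n → ∃ (x : ℕ → M4) (c : ℕ → Fin 4)
    (v : ℕ → NMatrix n), (∀ r, IsUnit (x r)) ∧ v 0 = 1 ∧
    (∀ j < T, embedGate (stPair hn (j * (n - 1) + (n - 2))) (kron2 1 (pauli (c j))) *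
        stC hn x (j * (n - 1) + (n - 2) + 1) = stC hn x (j * (n - 1) + (n - 2) + 1) * v (j + 1)) ∧
    LinearIndependent ℂ (fun i : Fin (T + 1) => v i) := by
  intro T
  induction T with
  | zero =>
    intro _
    refine ⟨fun _ => 1, fun _ => 0, fun _ => 1, fun _ => isUnit_one, rfl, by simp, ?_⟩
    have : Subsingleton (Fin (0 + 1)) := inferInstanceAs (Subsingleton (Fin 1))
    exact LinearIndependent.of_subsingleton' (R := ℂ) (0 : Fin (0 + 1)) (fun a h => by simpa using h)
  | succ T ih =>
    intro hT
    obtain ⟨x, c, v, hx, hv0, hj, hli⟩ := ih (by omega)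
    obtain ⟨f, D, hD, hDn⟩ := exists_new (stC hn x (T * (n - 1))) (stC_isUnit hn hx _)
      (fun i : Fin (T + 1) => v i) (by omega)
    obtain ⟨y, hy, hyu, c0, hc0⟩ := block_full hn T x hx f D hD
    refine ⟨y, Function.update c T c0, Function.update v (T + 1) D, hyu, ?_, ?_, ?_⟩
    · rw [Function.update_of_ne (by omega), hv0]
    · intro j hjT
      by_cases h : j = T
      · subst h
        rw [Function.update_self, Function.update_self]
        exact hc0
      · rw [Function.update_of_ne h, Function.update_of_ne (by omega)]
        have hle : j * (n - 1) + (n - 2) + 1 ≤ T * (n - 1) := by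
          have : (j + 1) * (n - 1) ≤ T * (n - 1) := Nat.mul_le_mul_right _ (by omega)
          rw [add_mul] at this
          omega
        rw [stC_congr hn (x := y) (y := x) _ fun r hr => hy r (by omega)]
        exact hj j (by omega)
    · rw [linearIndependent_finSucc']
      have e : Fin.init (fun i : Fin (T + 1 + 1) => Function.update v (T + 1) D (i : ℕ)) =
          fun i : Fin (T + 1) => v i := by
        funext i
        simp only [Fin.init, Fin.val_castSucc]
        rw [Function.update_of_ne (by have := i.isLt; omega)]
      rw [e]
      refine ⟨hli, ?_⟩
      simpa using hDn

theorem lower_rel (hn : 2 ≤ n) (T : ℕ) (hT : T + 1 ≤ 4 ^ n) :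
    ∃ l : NMatrix n →ₗ[ℂ] (Fin (T + 1) → ℂ), ∀ P : MvPolynomial (Fin (T + 1)) ℂ, P ≠ 0 →
      ∃ (g : Fin (T * (n - 1)) → M4) (c : ℂ),
        MvPolynomial.eval (l (c • contractM (staircase n T hn) g)) P ≠ 0 := by
  obtain ⟨x, c, v, hx, hv0, hj, hli⟩ := rank_ind hn T hT
  set N := T * (n - 1) with hN
  set F := stC hn x N with hF
  have hFu : IsUnit F := stC_isUnit hn hx N
  have hli2 : LinearIndependent ℂ (fun i : Fin (T + 1) => F * v i) := by
    refine hli.map' (LinearMap.mulLeft ℂ F) ?_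
    rw [LinearMap.ker_eq_bot]
    intro a b hab
    exact hFu.mul_left_cancel hab
  rw [linearIndependent_iff_injective_fintypeLinearCombination] at hli2
  obtain ⟨l, hl⟩ := LinearMap.exists_leftInverse_of_injective _ (LinearMap.ker_eq_bot.2 hli2)
  have hlv : ∀ i : Fin (T + 1), l (F * v i) = Pi.single i 1 := by
    intro i
    have := congrArg (fun φ => φ (Pi.single i (1 : ℂ))) hl
    simpa [Fintype.linearCombination_apply_single] using this
  refine ⟨l, fun P hP => ?_⟩
  by_contra hcon
  push Not at hcon
  let S : (Fin (T + 1) → ℂ) → ℕ → ℂ := fun s k => if h : k < T + 1 then s ⟨k, h⟩ else 0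
  let xs : (Fin (T + 1) → ℂ) → ℕ → M4 := fun s r =>
    (1 + (if r % (n - 1) = n - 2 then S s (r / (n - 1) + 1) else 0) •
      kron2 1 (pauli (c (r / (n - 1))))) * x r
  let h : (Fin (T + 1) → ℂ) → NMatrix n := fun s => s 0 • contractM (staircase n T hn) (fun i => xs s i)
  have hst : ∀ y : ℕ → M4, contractM (staircase n T hn) (fun i => y i) = stC hn y N :=
    fun y => stC_eq hn y N _ fun i => rfl
  have hQ : QPolyM h := by
    refine QPolyM.smul (QPoly.coord _) (QPolyM.contractM _ fun i => ?_)
    refine QPolyM.mul ((QPolyM.const 1).add (QPolyM.smul ?_ (QPolyM.const _))) (QPolyM.const _)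
    by_cases h1 : (i : ℕ) % (n - 1) = n - 2
    · by_cases h2 : (i : ℕ) / (n - 1) + 1 < T + 1
      · simp only [h1, if_true, S, h2, dif_pos]
        exact QPoly.coord _
      · simp only [h1, if_true, S, h2, dif_neg, not_false_iff]
        exact QPoly.const _
    · simp only [h1, if_false]
      exact QPoly.const _
  have hS0 : ∀ i : Fin (T + 1), ∀ k, S (Pi.single i 1) k = if k = i then 1 else 0 := by
    intro i k
    simp only [S]
    by_cases h1 : k < T + 1
    · rw [dif_pos h1, Pi.single_apply]
      simp [Fin.ext_iff]
    · rw [dif_neg h1, if_neg]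
      have := i.isLt
      omega
  have hSadd : ∀ (a b : Fin (T + 1) → ℂ) (t : ℂ) k, S (a + t • b) k = S a k + t * S b k := by
    intro a b t k
    simp only [S]
    split_ifs <;> simp
  have hS1 : ∀ k, S (Pi.single 0 1) (k + 1) = 0 := by
    intro k; rw [hS0]; simp
  have hxs0 : xs (Pi.single 0 1) = x := by
    funext r
    simp only [xs, hS1]
    simp
  have hh0 : h (Pi.single 0 1) = F := by
    simp only [h, hxs0, hst]
    simp [hF]
  have key : ∀ (i : Fin (T + 1)) (t : ℂ),
      h (Pi.single 0 1 + t • Pi.single i 1) = F + t • (F * v i) := by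
    intro i t
    refine Fin.cases ?_ (fun j => ?_) i
    · have : xs (Pi.single 0 1 + t • Pi.single 0 1) = x := by
        funext r
        simp only [xs, hSadd, hS1]
        simp
      simp only [h, this, hst]
      simp [hv0, add_smul, hF]
    · have hr : j.val * (n - 1) + (n - 2) + 1 ≤ N := by
        have : (j.val + 1) * (n - 1) ≤ T * (n - 1) := Nat.mul_le_mul_right _ j.isLt
        rw [add_mul] at this
        omega
      have : xs (Pi.single 0 1 + t • Pi.single j.succ 1) =
          Function.update x (j.val * (n - 1) + (n - 2))
            ((1 + t • kron2 1 (pauli (c j))) * x (j.val * (n - 1) + (n - 2))) := by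
        funext r
        simp only [xs, hSadd, hS1, hS0]
        by_cases hrj : r = j.val * (n - 1) + (n - 2)
        · have hm : r % (n - 1) = n - 2 := by
            rw [hrj]; exact Nat.mul_add_mod_of_lt (by omega)
          have hd : r / (n - 1) = j := by
            rw [hrj, mul_comm, Nat.mul_add_div (by omega), Nat.div_eq_of_lt (by omega), add_zero]
          rw [hm, hd, ← hrj, Function.update_self]
          simp
        · rw [Function.update_of_ne hrj]
          by_cases hm : r % (n - 1) = n - 2
          · have : ¬ (r / (n - 1) + 1 = (j.succ : ℕ)) := by
              intro h'
              apply hrj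
              have h'' : r / (n - 1) = j := by simpa using h'
              rw [← Nat.div_add_mod r (n - 1), hm, h'', mul_comm]
            rw [if_neg this]
            simp
          · rw [if_neg hm]
            simp
      simp only [h, this, hst]
      rw [stC_update hn x _ _ _ t (hj j j.isLt) N hr]
      simp [hF]
  have hp : Filter.map (fun s => l (h s)) (𝓝 (Pi.single 0 1)) = 𝓝 (l (h (Pi.single 0 1))) := by
    refine open_of_affine_pi _ _ (fun j => hQ.linear l j) (fun i => Pi.single i 1) ?_ ?_
    · intro i t
      have h1 := congrArg l (key i t)
      rw [map_add, map_smul l t, hlv i] at h1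
      simp only [hh0]
      convert h1
    · rw [← (Pi.basisFun ℂ (Fin (T + 1))).span_eq]
      congr 1
      ext; simp [Pi.basisFun_apply]
  apply hP
  refine MvPoly_zero_of_eventually P (l (h (Pi.single 0 1))) ?_
  rw [← hp, Filter.eventually_map]
  exact Filter.Eventually.of_forall fun s => hcon _ _
end Staircase

section NullSets
open Topology

def ordProd {M : Type*} [Monoid M] : (m : ℕ) → (Fin m → M) → M
  | 0, _ => 1
  | m + 1, f => f 0 * ordProd m (fun i => f i.succ)

theorem ordProd_one {M : Type*} [Monoid M] : ∀ m, ordProd m (fun _ : Fin m => (1 : M)) = 1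
  | 0 => rfl
  | m + 1 => by simp [ordProd, ordProd_one m]

theorem ordProd_single : ∀ (m : ℕ) (i : Fin m) (B : M4),
    ordProd m (fun k => 1 + if k = i then B else 0) = 1 + B
  | 0, i, _ => i.elim0
  | m + 1, i, B => by
    simp only [ordProd]
    refine Fin.cases ?_ (fun j => ?_) i
    · simp [Fin.succ_ne_zero, ordProd_one]
    · rw [if_neg (Fin.succ_ne_zero j).symm]
      simp only [Fin.succ_inj]
      rw [ordProd_single m j B]
      simp

theorem ordProd_smul : ∀ (m : ℕ) (t : Fin m → ℂ) (f : Fin m → M4),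
    ordProd m (fun k => t k • f k) = (∏ k, t k) • ordProd m f
  | 0, _, _ => by simp [ordProd]
  | m + 1, t, f => by
    simp only [ordProd]
    rw [ordProd_smul m (fun i => t i.succ) (fun i => f i.succ), Fin.prod_univ_succ,
      Matrix.smul_mul, Matrix.mul_smul, smul_smul]

theorem ordProd_coe : ∀ (m : ℕ) (f : Fin m → SU4),
    ((ordProd m f : SU4) : M4) = ordProd m (fun k => (f k : M4))
  | 0, _ => rfl
  | m + 1, f => by
    simp only [ordProd]
    rw [← ordProd_coe m]
    rfl

theorem continuous_ordProd {X : Type*} [TopologicalSpace X] : ∀ (m : ℕ) (f : X → Fin m → SU4)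
    (_ : ∀ k, Continuous fun x => f x k), Continuous fun x => ordProd m (f x)
  | 0, _, _ => continuous_const
  | m + 1, f, hf => by
    simp only [ordProd]
    exact (hf 0).mul (continuous_ordProd m (fun x i => f x i.succ) fun k => hf _)

theorem QPolyM.ordProd {σ : Type} : ∀ (m : ℕ) (f : (σ → ℂ) → Fin m → M4)
    (_ : ∀ k, QPolyM (fun z => f z k)), QPolyM (fun z => ordProd m (f z))
  | 0, _, _ => QPolyM.const 1
  | m + 1, f, hf => QPolyM.mul (hf 0) (QPolyM.ordProd m (fun z i => f z i.succ) fun k => hf _)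

noncomputable def pK (k : Fin 4 × Fin 4) : M4 := kron2 (pauli k.1) (pauli k.2)

theorem pK_sq (k : Fin 4 × Fin 4) : pK k * pK k = 1 := by
  rw [pK, kron2_mul, pauli_sq, pauli_sq, kron2_one]
theorem pK_herm (k : Fin 4 × Fin 4) : (pK k)ᴴ = pK k := by
  rw [pK, kron2_herm, pauli_herm, pauli_herm]

noncomputable def normF (s : ℝ) : ℂ := ((Real.sqrt (1 + s ^ 2) : ℝ) : ℂ)

theorem normF_sq (s : ℝ) : normF s ^ 2 = 1 + (s : ℂ) ^ 2 := by
  rw [normF, ← Complex.ofReal_pow, Real.sq_sqrt (by positivity)]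
  push_cast; ring
theorem normF_ne (s : ℝ) : normF s ≠ 0 := by
  rw [normF]
  exact_mod_cast (Real.sqrt_pos.2 (by positivity)).ne'

theorem uGate_mem (s : ℝ) (k : Fin 4 × Fin 4) :
    (if k = (0, 0) then (1 : M4) else (normF s)⁻¹ • (1 + (Complex.I * s) • pK k)) ∈
      Matrix.specialUnitaryGroup (Fin 4) ℂ := by
  by_cases hk : k = (0, 0)
  · rw [if_pos hk]; exact one_mem _
  rw [if_neg hk, Matrix.mem_specialUnitaryGroup_iff]
  constructor
  · rw [Matrix.mem_unitaryGroup_iff']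
    have hst : star (normF s) = normF s := by
      rw [normF]; exact Complex.conj_ofReal _
    have h1 : star ((normF s)⁻¹ • (1 + (Complex.I * s) • pK k)) =
        (normF s)⁻¹ • (1 - (Complex.I * s) • pK k) := by
      rw [star_smul, star_inv₀, hst, Matrix.star_eq_conjTranspose, Matrix.conjTranspose_add,
        Matrix.conjTranspose_smul, pK_herm, Matrix.conjTranspose_one]
      simp [sub_eq_add_neg]
    rw [h1, Matrix.smul_mul, Matrix.mul_smul, smul_smul]
    have h2 : (1 - (Complex.I * s) • pK k) * (1 + (Complex.I * s) • pK k) =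
        (normF s ^ 2) • (1 : M4) := by
      rw [sub_mul, mul_add, mul_add, one_mul, one_mul, mul_one, Matrix.smul_mul, Matrix.mul_smul,
        pK_sq, smul_smul, normF_sq, add_smul, one_smul]
      have : Complex.I * s * (Complex.I * s) = - (s : ℂ) ^ 2 := by
        have := Complex.I_mul_I
        linear_combination (s : ℂ) ^ 2 * this
      rw [this, neg_smul]
      abel
    rw [h2, smul_smul]
    have := normF_ne s
    have h3 : (normF s)⁻¹ * (normF s)⁻¹ * normF s ^ 2 = 1 := by field_simp
    rw [h3, one_smul]
  · rw [Matrix.det_smul, pK, det_one_add]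
    · rw [← normF_sq]
      have := normF_ne s
      simp only [Fintype.card_fin]
      field_simp
    · by_contra hc
      push Not at hc
      exact hk (Prod.ext hc.1 hc.2)

noncomputable def uGate (s : ℝ) (k : Fin 4 × Fin 4) : SU4 := ⟨_, uGate_mem s k⟩

noncomputable def uLam (s : ℝ) (k : Fin 4 × Fin 4) : ℂ :=
  if k = (0, 0) then 1 + Complex.I * s else normF s

theorem uGate_eq (s : ℝ) (k : Fin 4 × Fin 4) :
    1 + (Complex.I * s) • pK k = uLam s k • (uGate s k : M4) := by
  unfold uLam uGate
  by_cases hk : k = (0, 0)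
  · subst hk
    simp [pK, pauli_zero, kron2_one, add_smul]
  · simp only [if_neg hk]
    rw [smul_smul, mul_inv_cancel₀ (normF_ne s), one_smul]

theorem continuous_uGate (k : Fin 4 × Fin 4) : Continuous fun s => uGate s k := by
  unfold uGate
  refine Continuous.subtype_mk ?_ _
  by_cases hk : k = (0, 0)
  · simp only [if_pos hk]; exact continuous_const
  · simp only [if_neg hk]
    refine Continuous.smul (Continuous.inv₀ ?_ normF_ne) ?_
    · unfold normF; fun_prop
    · fun_prop

noncomputable def kIdx (k : Fin 16) : Fin 4 × Fin 4 := (finProdFinEquiv (m := 4) (n := 4)).symm k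

noncomputable def psi (w : Fin 16 → ℂ) : M4 :=
  ordProd 16 (fun k => 1 + (Complex.I * w k) • pK (kIdx k))

theorem QPolyM.psi {σ : Type} {w : (σ → ℂ) → Fin 16 → ℂ} (hw : ∀ k, QPoly (fun z => w z k)) :
    QPolyM (fun z => psi (w z)) :=
  QPolyM.ordProd 16 _ fun k => (QPolyM.const 1).add
    (QPolyM.smul ((QPoly.const _).mul (hw k)) (QPolyM.const _))

theorem psi_open : ∀ᶠ M in 𝓝 (1 : M4), ∃ w, psi w = M := by
  have h0 : psi 0 = 1 := by simp [psi, ordProd_one]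
  have h1 : Filter.map psi (𝓝 0) = 𝓝 (psi 0) := by
    refine open_of_affine_mat psi 0 (QPolyM.psi (w := fun z => z) fun k => QPoly.coord k)
      (fun k => Complex.I • pK (kIdx k)) ?_ ?_
    · intro i t
      rw [h0, zero_add]
      have : (fun k : Fin 16 => (1 : M4) +
          (Complex.I * (t • (Pi.single i 1 : Fin 16 → ℂ)) k) • pK (kIdx k)) =
          fun k => 1 + if k = i then t • Complex.I • pK (kIdx i) else 0 := by
        funext k
        by_cases hk : k = i
        · subst hk; simp [smul_smul, mul_comm]
        · simp [hk]
      rw [← ordProd_single 16 i, ← this, psi]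
      congr!
    · have hsp := span_kron_pauli
      rw [eq_top_iff, ← hsp, Submodule.span_le]
      rintro _ ⟨k, rfl⟩
      have : kron2 (pauli k.1) (pauli k.2) =
          (-Complex.I) • (Complex.I • pK (kIdx (finProdFinEquiv k))) := by
        rw [smul_smul]
        simp [kIdx, pK]
      show kron2 (pauli k.1) (pauli k.2) ∈ _
      rw [this]
      exact Submodule.smul_mem _ _ (Submodule.subset_span ⟨_, rfl⟩)
  have h2 := Filter.image_mem_map (m := psi) (Filter.univ_mem (f := 𝓝 0))
  rw [h1, h0] at h2
  filter_upwards [h2]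
  rintro M ⟨w, -, rfl⟩
  exact ⟨w, rfl⟩

noncomputable def phiS {R : ℕ} (s : Fin (R * 16) → ℝ) (r : Fin R) : SU4 :=
  ordProd 16 (fun k => uGate (s (finProdFinEquiv (r, k))) (kIdx k))

theorem phiS_eq {R : ℕ} (s : Fin (R * 16) → ℝ) (r : Fin R) :
    psi (fun k => (s (finProdFinEquiv (r, k)) : ℂ)) =
      (∏ k, uLam (s (finProdFinEquiv (r, k))) (kIdx k)) • (phiS s r : M4) := by
  rw [phiS, ordProd_coe, ← ordProd_smul, psi]
  simp only [uGate_eq]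

instance : SecondCountableTopology SU4 :=
  haveI : SecondCountableTopology M4 :=
    inferInstanceAs (SecondCountableTopology (Fin 4 → Fin 4 → ℂ))
  (Topology.IsInducing.subtypeVal
    (t := (Matrix.specialUnitaryGroup (Fin 4) ℂ : Set M4))).secondCountableTopology

instance : haarSU4.IsMulLeftInvariant := by
  unfold haarSU4; infer_instance

instance (R : ℕ) : (muSU4 R).IsMulLeftInvariant := by
  unfold muSU4; infer_instance

instance (R : ℕ) : IsProbabilityMeasure (muSU4 R) := by
  unfold muSU4; infer_instance

theorem phiS_mul_coe {R : ℕ} (y x : Fin R → SU4) (i : Fin R) :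
    ((y * x) i : M4) = (y i : M4) * (x i : M4) := rfl

set_option maxHeartbeats 1000000 in
theorem ae_ne_fix {n R : ℕ} (A : Architecture n R) {ι : Type} [Fintype ι]
    (l : NMatrix n →ₗ[ℂ] (ι → ℂ)) (P : MvPolynomial ι ℂ)
    (h : ∃ (g : Fin R → M4) (c : ℂ), MvPolynomial.eval (l (c • contractM A g)) P ≠ 0)
    (x : Fin R → SU4) : ∀ᵐ s : Fin (R * 16) → ℝ, ∃ c : ℂ,
      MvPolynomial.eval (l (c • contractM A (fun i => ((phiS s * x) i : M4)))) P ≠ 0 := by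
  have hex : ∃ (z : Fin (R * 16) → ℂ) (c : ℂ), MvPolynomial.eval (l (c • contractM A
      (fun i => psi (fun k => z (finProdFinEquiv (i, k))) * (x i : M4)))) P ≠ 0 := by
    by_contra hcon
    push Not at hcon
    obtain ⟨g0, c0, hg0⟩ := h
    apply hg0
    let G : (Fin R × Fin 4 × Fin 4 → ℂ) → (Fin R → M4) := fun z j a b => z (j, a, b)
    have hq : QPoly (fun z : Fin R × Fin 4 × Fin 4 → ℂ =>
        MvPolynomial.eval (l (c0 • contractM A (G z))) P) := by
      refine QPoly.comp P (f := fun i z => l (c0 • contractM A (G z)) i) fun i => ?_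
      refine QPolyM.linear ?_ l i
      exact QPolyM.smul (QPoly.const _) (QPolyM.contractM A fun i a b => QPoly.coord _)
    refine hq.zero_of_eventually (fun k => (x k.1 : M4) k.2.1 k.2.2) ?_
      (fun k => g0 k.1 k.2.1 k.2.2)
    have hxs : ∀ i, (x i : M4) * star (x i : M4) = 1 := fun i =>
      Matrix.mem_unitaryGroup_iff.1 (Matrix.mem_specialUnitaryGroup_iff.1 (x i).2).1
    have hxs' : ∀ i, star (x i : M4) * (x i : M4) = 1 := fun i =>
      Matrix.mem_unitaryGroup_iff'.1 (Matrix.mem_specialUnitaryGroup_iff.1 (x i).2).1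
    have hev : ∀ᶠ z in 𝓝 (fun k : Fin R × Fin 4 × Fin 4 => (x k.1 : M4) k.2.1 k.2.2),
        ∀ i, ∃ w, psi w = G z i * star (x i : M4) := by
      rw [Filter.eventually_all]
      intro i
      have hc : Continuous fun z => G z i * star (x i : M4) := by
        refine Continuous.matrix_mul ?_ continuous_const
        exact continuous_pi fun a => continuous_pi fun b => continuous_apply _
      have ht := hc.tendsto (fun k : Fin R × Fin 4 × Fin 4 => (x k.1 : M4) k.2.1 k.2.2)
      have e : G (fun k : Fin R × Fin 4 × Fin 4 => (x k.1 : M4) k.2.1 k.2.2) i = (x i : M4) := rfl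
      rw [e, hxs] at ht
      exact ht.eventually psi_open
    filter_upwards [hev] with z hz
    choose w hw using hz
    have := hcon (fun k => w (finProdFinEquiv.symm k).1 (finProdFinEquiv.symm k).2) c0
    simp only [Equiv.symm_apply_apply] at this
    have e : (fun i => psi (w i) * (x i : M4)) = G z := by
      funext i
      rw [hw, Matrix.mul_assoc, hxs', mul_one]
    have e2 : (fun i => psi (fun k => w i k) * (x i : M4)) = G z := e
    rw [e2] at this
    exact this
  obtain ⟨z, c, hz⟩ := hex
  have hq : QPoly (fun z : Fin (R * 16) → ℂ => MvPolynomial.eval (l (c • contractM A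
      (fun i => psi (fun k => z (finProdFinEquiv (i, k))) * (x i : M4)))) P) := by
    refine QPoly.comp P (f := fun j z => l (c • contractM A
      (fun i => psi (fun k => z (finProdFinEquiv (i, k))) * (x i : M4))) j) fun j => ?_
    refine QPolyM.linear ?_ l j
    refine QPolyM.smul (QPoly.const _) (QPolyM.contractM A fun i => ?_)
    exact QPolyM.mul (QPolyM.psi fun k => QPoly.coord _) (QPolyM.const _)
  filter_upwards [hq.ae_ne_zero z hz] with s hs
  refine ⟨c * ∏ r, ∏ k, uLam (s (finProdFinEquiv (r, k))) (kIdx k), ?_⟩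
  rw [mul_smul, ← contractM_smul]
  simp only [phiS_eq, Matrix.smul_mul] at hs
  simp only [phiS_mul_coe]
  exact hs

theorem continuous_contractM {n : ℕ} : ∀ {R : ℕ} (A : Architecture n R),
    Continuous fun x : Fin R → SU4 => contractM A (fun i => (x i : M4)) := by
  intro R
  induction R with
  | zero => exact fun _ => continuous_const
  | succ R ih =>
    intro A
    simp only [contractM]
    refine Continuous.matrix_mul ?_ ((ih _).comp
      (continuous_pi fun i => continuous_apply (Fin.castSucc i)))
    refine continuous_pi fun a => continuous_pi fun b => ?_
    simp only [embedGate]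
    split_ifs
    · exact Continuous.matrix_elem (continuous_subtype_val.comp (continuous_apply _)) _ _
    · exact continuous_const

theorem continuous_phiS (R : ℕ) :
    Continuous fun s : Fin (R * 16) → ℝ => (phiS s : Fin R → SU4) := by
  refine continuous_pi fun r => continuous_ordProd 16 _ fun k => ?_
  exact (continuous_uGate _).comp (continuous_apply _)

theorem isOpen_good {n R : ℕ} (A : Architecture n R) {ι : Type} [Fintype ι]
    (l : NMatrix n →ₗ[ℂ] (ι → ℂ)) (P : MvPolynomial ι ℂ) :
    IsOpen {x : Fin R → SU4 | ∃ c : ℂ,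
      MvPolynomial.eval (l (c • contractM A (fun i => (x i : M4)))) P ≠ 0} := by
  have hcontl : Continuous fun M : NMatrix n => l M := l.continuous_of_finiteDimensional
  have hopen : ∀ c : ℂ, IsOpen {x : Fin R → SU4 |
      MvPolynomial.eval (l (c • contractM A (fun i => (x i : M4)))) P ≠ 0} := by
    intro c
    refine IsOpen.preimage (f := fun x : Fin R → SU4 =>
      MvPolynomial.eval (l (c • contractM A (fun i => (x i : M4)))) P) ?_ isOpen_compl_singleton
    exact (MvPolynomial.continuous_eval P).comp
      (hcontl.comp ((continuous_contractM A).const_smul c))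
  rw [Set.ofPred_exists]
  exact isOpen_iUnion hopen

theorem ae_of_translates {X Y : Type*} [Group X] [MeasurableSpace X] [MeasurableMul X]
    [MeasurableSpace Y] (μ : Measure X) [SFinite μ] [μ.IsMulLeftInvariant] (ν : Measure Y)
    [SFinite ν] [Filter.NeBot (ae ν)] (φ : Y → X) (G : Set X)
    (hm : MeasurableSet {q : X × Y | φ q.2 * q.1 ∈ G})
    (h : ∀ x, ∀ᵐ s ∂ν, φ s * x ∈ G) : ∀ᵐ x ∂μ, x ∈ G := by
  have hcomm := (Measure.ae_ae_comm (μ := μ) (ν := ν)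
    (p := fun x s => φ s * x ∈ G) hm).1 (Filter.Eventually.of_forall h)
  obtain ⟨s, hs⟩ := hcomm.exists
  exact (eventually_mul_left_iff μ (φ s) (p := fun x => x ∈ G)).1 hs

theorem ae_ne {n R : ℕ} (A : Architecture n R) {ι : Type} [Fintype ι]
    (l : NMatrix n →ₗ[ℂ] (ι → ℂ)) (P : MvPolynomial ι ℂ)
    (h : ∃ (g : Fin R → M4) (c : ℂ), MvPolynomial.eval (l (c • contractM A g)) P ≠ 0) :
    ∀ᵐ x ∂(muSU4 R), ∃ c : ℂ,
      MvPolynomial.eval (l (c • contractM A (fun i => (x i : M4)))) P ≠ 0 := by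
  have hfix := ae_ne_fix A l P h
  have hopen := isOpen_good A l P
  have hc : Continuous fun q : (Fin R → SU4) × (Fin (R * 16) → ℝ) => phiS q.2 * q.1 :=
    ((continuous_phiS R).comp continuous_snd).mul continuous_fst
  have hm := (hopen.preimage hc).measurableSet
  generalize hG : {x : Fin R → SU4 | ∃ c : ℂ,
      MvPolynomial.eval (l (c • contractM A (fun i => (x i : M4)))) P ≠ 0} = G at hm
  have hfix2 : ∀ x : Fin R → SU4, ∀ᵐ s : Fin (R * 16) → ℝ, phiS s * x ∈ G := by
    intro x
    subst hG
    exact hfix x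
  have := ae_of_translates (muSU4 R) (volume : Measure (Fin (R * 16) → ℝ)) phiS G hm hfix2
  subst hG
  exact this
end NullSets

theorem staircase_slices (n T : ℕ) (hn : 2 ≤ n) (s : ℕ) (hs : s < T) :
    IsCausalSliceWith (staircase n T hn) (s * (n - 1)) ((s + 1) * (n - 1))
      ⟨n - 1, by omega⟩ := by
  intro q
  have hq := q.isLt
  have hle : (s + 1) * (n - 1) ≤ T * (n - 1) := Nat.mul_le_mul_right _ hs
  have hexp : (s + 1) * (n - 1) = s * (n - 1) + (n - 1) := by ring
  have hmod : ∀ k, k < n - 1 → (s * (n - 1) + k) % (n - 1) = k := fun k hk => by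
    rw [Nat.mul_add_mod_self_right, Nat.mod_eq_of_lt hk]
  refine ⟨n - 1 - q, fun l => ⟨s * (n - 1) + (q + l), by have := l.isLt; omega⟩,
    fun l => ⟨q + l, by have := l.isLt; omega⟩, ?_, ?_, ?_, ?_, ?_⟩
  · intro a b hab
    simp only [Fin.lt_def] at hab ⊢
    omega
  · intro l
    have := l.isLt
    simp only
    omega
  · ext; simp
  · ext; simp; omega
  · intro l
    have := l.isLt
    have h := hmod (q + l) (by omega)
    refine ⟨Or.inl ?_, Or.inr ?_⟩
    · ext; simp [staircase, h]
    · ext; simp [staircase, h]; omega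

instance (n R : ℕ) : Countable (Architecture n R) :=
  inferInstanceAs (Countable (Fin R → {p : Fin n × Fin n // p.1 ≠ p.2}))

theorem staircase_growth (n T : ℕ) (hn : 2 ≤ n) (hT : T ≤ 4 ^ n - 1) :
    ∀ᵐ x ∂(muSU4 (T * (n - 1))),
      ((T * (n - 1) : ℕ) : ℝ) / (9 * ((n : ℝ) - 1)) - (n : ℝ) / 3 ≤
        (Cu n (contract (staircase n T hn) x) : ℝ) := by
  have h4 : 0 < 4 ^ n := by positivity
  obtain ⟨l, hl⟩ := lower_rel hn T (by omega)
  have key : ∀ (R' : ℕ) (A' : Architecture n R'), ∀ᵐ x ∂(muSU4 (T * (n - 1))),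
      9 * R' + 3 * n < T → ∀ y : Fin R' → SU4, contract A' y ≠ contract (staircase n T hn) x := by
    intro R' A'
    by_cases hR : 9 * R' + 3 * n < T
    · obtain ⟨P, hP, hP0⟩ := upper_rel (by omega) A' (ι := Fin (T + 1))
        (by rw [Fintype.card_fin]; omega) l
      filter_upwards [ae_ne (staircase n T hn) l P (hl P hP)] with x hx _ y hy
      obtain ⟨c, hc⟩ := hx
      apply hc
      rw [← contract_eq, ← hy, contract_eq]
      exact hP0 _ c
    · exact Filter.Eventually.of_forall fun x h => absurd h hR
  have key2 : ∀ᵐ x ∂(muSU4 (T * (n - 1))), ∀ (R' : ℕ) (A' : Architecture n R'),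
      9 * R' + 3 * n < T → ∀ y : Fin R' → SU4, contract A' y ≠ contract (staircase n T hn) x :=
    ae_all_iff.2 fun R' => ae_all_iff.2 fun A' => key R' A'
  filter_upwards [key2] with x hx
  have hmem : Cu n (contract (staircase n T hn) x) ∈
      {R | ∃ A : Architecture n R, ∃ y : Fin R → SU4,
        contract A y = contract (staircase n T hn) x} :=
    Nat.sInf_mem ⟨_, staircase n T hn, x, rfl⟩
  obtain ⟨A', y, hy⟩ := hmem
  have hle : T ≤ 9 * Cu n (contract (staircase n T hn) x) + 3 * n := by
    by_contra hcon
    exact hx _ A' (by omega) y hy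
  have hle2 : (T : ℝ) ≤ 9 * (Cu n (contract (staircase n T hn) x) : ℝ) + 3 * n := by
    exact_mod_cast hle
  have hn1 : (0 : ℝ) < (n : ℝ) - 1 := by
    have : (2 : ℝ) ≤ n := by exact_mod_cast hn
    linarith
  have e : ((T * (n - 1) : ℕ) : ℝ) / (9 * ((n : ℝ) - 1)) = T / 9 := by
    rw [Nat.cast_mul, Nat.cast_sub (by omega), Nat.cast_one]
    field_simp
  rw [e]
  linarith

/-- **The staircase architecture: causal slices and linear complexity growth.**  For
`n ≥ 2` and `T ≤ 4^n − 1`: (i) each of the `T` blocks of `n−1` consecutive gates of the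
staircase architecture is a causal slice with sink qubit `n`; and (ii) with unit probability
over the Haar-random gates, the unitary implemented by the staircase circuit with
`R = T(n−1)` gates has exact circuit complexity at least `R/(9(n−1)) − n/3`. -/
theorem staircase_causal_slices_and_linear_growth
    (n T : ℕ) (hn : 2 ≤ n) (hT : T ≤ 4 ^ n - 1) :
    (∀ s < T, IsCausalSliceWith (staircase n T hn) (s * (n - 1)) ((s + 1) * (n - 1))
      ⟨n - 1, by omega⟩) ∧
    ∀ᵐ x ∂(muSU4 (T * (n - 1))),
      ((T * (n - 1) : ℕ) : ℝ) / (9 * ((n : ℝ) - 1)) - (n : ℝ) / 3 ≤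
        (Cu n (contract (staircase n T hn) x) : ℝ) := by
  exact ⟨fun s hs => staircase_slices n T hn s hs, staircase_growth n T hn hT⟩
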